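/- Every Lie superbialgebra structure on the centerless N=2 superconformal Neveu-Schwarz algebra L is triangular coboundary: for any cobracket Δ making (L, [·,·], Δ) a Lie superbialgebra, there exists an even r ∈ Im(1−τ) ⊆ L⊗L with c(r) = 0 such that Δ(x) = x ∗ r for all x ∈ L. -/

import Mathlib

noncomputable section
open Finsupp

/-- Sign `(-1)^(a*b)` for parities `a b : ZMod 2`. -/
def sg (a b : ZMod 2) : ℂ := if a * b = 1 then -1 else 1

/-- A (basis-presented) superalgebra datum: a basis `ι`, a parity function and
structure "constants" giving the bracket of two basis elements. -/
structure SuperData where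
  ι : Type
  par : ι → ZMod 2
  br : ι → ι → (ι →₀ ℂ)

namespace SuperData

variable (D : SuperData)

/-- The underlying vector space, with basis `ι`. -/
abbrev V := D.ι →₀ ℂ

/-- The tensor square `V ⊗ V`, modelled on the basis `ι × ι`. -/
abbrev T2 := (D.ι × D.ι) →₀ ℂ

/-- The tensor cube `V ⊗ V ⊗ V`. -/
abbrev T3 := (D.ι × D.ι × D.ι) →₀ ℂ

/-- The `n`-fold tensor power. -/
abbrev Tn (n : ℕ) := ((Fin n → D.ι) →₀ ℂ)

/-- Basis vectors. -/
def e (i : D.ι) : D.V := Finsupp.single i 1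

/-- Linear extension of a map defined on the basis. -/
def lift {α : Type*} {M : Type*} [AddCommGroup M] [Module ℂ M] (g : α → M) :
    (α →₀ ℂ) →ₗ[ℂ] M :=
  Finsupp.linearCombination ℂ g

/-- The bilinear bracket extending `D.br`. -/
def brk : D.V →ₗ[ℂ] D.V →ₗ[ℂ] D.V :=
  lift fun i => lift fun j => D.br i j

/-- Bilinear tensor-product map `V × V → V ⊗ V`. -/
def tens2 : D.V →ₗ[ℂ] D.V →ₗ[ℂ] D.T2 :=
  lift fun i => lift fun j => Finsupp.single (i, j) 1

/-- Trilinear tensor-product map. -/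
def tens3 : D.V →ₗ[ℂ] D.V →ₗ[ℂ] D.V →ₗ[ℂ] D.T3 :=
  lift fun i => lift fun j => lift fun k => Finsupp.single (i, j, k) 1

/-- The super-twist map `τ(x ⊗ y) = (-1)^{|x||y|} y ⊗ x`. -/
def tau : D.T2 →ₗ[ℂ] D.T2 :=
  lift fun p => sg (D.par p.1) (D.par p.2) • Finsupp.single (p.2, p.1) 1

/-- The super-cyclic map `ξ = (1⊗τ)(τ⊗1)` on the tensor cube. -/
def xi : D.T3 →ₗ[ℂ] D.T3 :=
  lift fun p => sg (D.par p.1) (D.par p.2.1 + D.par p.2.2) •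
    Finsupp.single (p.2.1, p.2.2, p.1) 1

/-- The adjoint diagonal action of `V` on `V ⊗ V`:
`x ∗ (a⊗b) = [x,a]⊗b + (-1)^{|x||a|} a⊗[x,b]`. -/
def star2 : D.V →ₗ[ℂ] D.T2 →ₗ[ℂ] D.T2 :=
  lift fun k => lift fun p =>
    D.tens2 (D.br k p.1) (D.e p.2) +
      sg (D.par k) (D.par p.1) • D.tens2 (D.e p.1) (D.br k p.2)

/-- The adjoint diagonal action of `V` on `V ⊗ V ⊗ V`. -/
def star3 : D.V →ₗ[ℂ] D.T3 →ₗ[ℂ] D.T3 :=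
  lift fun k => lift fun p =>
    D.tens3 (D.br k p.1) (D.e p.2.1) (D.e p.2.2) +
      sg (D.par k) (D.par p.1) • D.tens3 (D.e p.1) (D.br k p.2.1) (D.e p.2.2) +
      sg (D.par k) (D.par p.1 + D.par p.2.1) •
        D.tens3 (D.e p.1) (D.e p.2.1) (D.br k p.2.2)

/-- The adjoint diagonal action of `V` on the `n`-fold tensor power, with Koszul signs. -/
def starN (n : ℕ) : D.V →ₗ[ℂ] D.Tn n →ₗ[ℂ] D.Tn n :=
  lift fun k => lift fun f =>
    ∑ i : Fin n, sg (D.par k) (∑ j ∈ Finset.Iio i, D.par (f j)) •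
      Finsupp.mapDomain (Function.update f i) (D.br k (f i))

/-- `c(r) = [r¹²,r¹³] + [r¹²,r²³] + [r¹³,r²³]`, the Yang–Baxter expression. -/
def cybe (r : D.T2) : D.T3 :=
  r.sum fun p a => r.sum fun q b => (a * b) •
    (sg (D.par q.1) (D.par p.2) •
        (D.tens3 (D.br p.1 q.1) (D.e p.2) (D.e q.2) +
          D.tens3 (D.e p.1) (D.e q.1) (D.br p.2 q.2)) +
      D.tens3 (D.e p.1) (D.br p.2 q.1) (D.e q.2))

/-- The image of `1 - τ` in `V ⊗ V`. -/
def ImSkew : Submodule ℂ D.T2 := LinearMap.range (LinearMap.id - D.tau)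

/-- `x` is homogeneous of parity `dp`. -/
def Homog1 (dp : ZMod 2) (x : D.V) : Prop := ∀ i ∈ x.support, D.par i = dp

/-- `t ∈ V ⊗ V` is homogeneous of parity `dp`. -/
def Homog2 (dp : ZMod 2) (t : D.T2) : Prop :=
  ∀ p ∈ t.support, D.par p.1 + D.par p.2 = dp

/-- `t ∈ V ⊗ V` is even. -/
def IsEven2 (t : D.T2) : Prop := D.Homog2 0 t

/-- Super skew-symmetry of the bracket (on homogeneous elements). -/
def SuperSkew : Prop :=
  ∀ (px py : ZMod 2) (x y : D.V), D.Homog1 px x → D.Homog1 py y →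
    D.brk x y = -sg px py • D.brk y x

/-- The graded Jacobi identity
`(-1)^{|x||z|}[x,[y,z]] + (-1)^{|y||x|}[y,[z,x]] + (-1)^{|z||y|}[z,[x,y]] = 0`. -/
def SuperJacobi : Prop :=
  ∀ (px py pz : ZMod 2) (x y z : D.V), D.Homog1 px x → D.Homog1 py y → D.Homog1 pz z →
    sg px pz • D.brk x (D.brk y z) + sg py px • D.brk y (D.brk z x) +
      sg pz py • D.brk z (D.brk x y) = 0

/-- `D` presents a Lie superalgebra. -/
def IsLieSuper : Prop := D.SuperSkew ∧ D.SuperJacobi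

/-- `f : V → V ⊗ V` is a homogeneous derivation of parity `dp`. -/
def IsDer2 (dp : ZMod 2) (f : D.V →ₗ[ℂ] D.T2) : Prop :=
  ∀ i j, f (D.br i j) =
    sg dp (D.par i) • D.star2 (D.e i) (f (D.e j)) -
      sg (D.par j) (dp + D.par i) • D.star2 (D.e j) (f (D.e i))

/-- `f : V → V` is a homogeneous derivation of parity `dp` (adjoint coefficients). -/
def IsDerV (dp : ZMod 2) (f : D.V →ₗ[ℂ] D.V) : Prop :=
  ∀ i j, f (D.br i j) =
    sg dp (D.par i) • D.brk (D.e i) (f (D.e j)) -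
      sg (D.par j) (dp + D.par i) • D.brk (D.e j) (f (D.e i))

/-- `(1 ⊗ Δ)` as a map `V⊗V → V⊗V⊗V`, for `Δ : V → V⊗V`. -/
def oneDelta (Δf : D.V →ₗ[ℂ] D.T2) : D.T2 →ₗ[ℂ] D.T3 :=
  lift fun p => Finsupp.mapDomain (fun q : D.ι × D.ι => (p.1, q.1, q.2)) (Δf (D.e p.2))

/-- `Δf` makes `D` into a Lie superbialgebra: `Δf` respects the `ℤ₂`-grading, has image
in `Im(1-τ)`, satisfies co-Jacobi, and is compatible with the bracket via the
adjoint diagonal action. -/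
def IsSBialg (Δf : D.V →ₗ[ℂ] D.T2) : Prop :=
  (∀ (dp : ZMod 2) (x : D.V), D.Homog1 dp x → D.Homog2 dp (Δf x)) ∧
  (∀ x : D.V, Δf x ∈ D.ImSkew) ∧
  (∀ x : D.V, D.oneDelta Δf (Δf x) + D.xi (D.oneDelta Δf (Δf x)) +
      D.xi (D.xi (D.oneDelta Δf (Δf x))) = 0) ∧
  (∀ i j, Δf (D.br i j) =
    D.star2 (D.e i) (Δf (D.e j)) - sg (D.par i) (D.par j) • D.star2 (D.e j) (Δf (D.e i)))

end SuperData

open SuperData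

/-- Basis of the centerless `N=2` superconformal Neveu–Schwarz algebra:
`L m`, `I m` for `m : ℤ`, and `G s k` denoting `G_{k+1/2}^±` (`s = true` for `+`). -/
inductive NSI : Type
  | L : ℤ → NSI
  | I : ℤ → NSI
  | G : Bool → ℤ → NSI
  deriving DecidableEq

/-- Structure constants of the centerless `N=2` Neveu–Schwarz algebra
(`G s k` stands for `G^±_r` with `r = k + 1/2`). -/
def nsBr : NSI → NSI → (NSI →₀ ℂ)
  | .L m, .L n => ((m : ℂ) - n) • Finsupp.single (.L (m + n)) 1
  | .L m, .I n => (-(n : ℂ)) • Finsupp.single (.I (m + n)) 1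
  | .I m, .L n => (m : ℂ) • Finsupp.single (.I (m + n)) 1
  | .I _, .I _ => 0
  | .L m, .G s k => (((m : ℂ) - 2 * k - 1) / 2) • Finsupp.single (.G s (m + k)) 1
  | .G s k, .L m => (-(((m : ℂ) - 2 * k - 1) / 2)) • Finsupp.single (.G s (m + k)) 1
  | .I m, .G s k => (if s then (1 : ℂ) else -1) • Finsupp.single (.G s (m + k)) 1
  | .G s k, .I m => (if s then (-1 : ℂ) else 1) • Finsupp.single (.G s (m + k)) 1
  | .G true k, .G false l =>
      (2 : ℂ) • Finsupp.single (.L (k + l + 1)) 1 +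
        ((k : ℂ) - l) • Finsupp.single (.I (k + l + 1)) 1
  | .G false k, .G true l =>
      (2 : ℂ) • Finsupp.single (.L (k + l + 1)) 1 +
        ((l : ℂ) - k) • Finsupp.single (.I (k + l + 1)) 1
  | .G true _, .G true _ => 0
  | .G false _, .G false _ => 0

/-- Parity on the Neveu–Schwarz basis. -/
def nsPar : NSI → ZMod 2
  | .G _ _ => 1
  | _ => 0

/-- The centerless `N=2` superconformal Neveu–Schwarz algebra. -/
def NSd : SuperData := ⟨NSI, nsPar, nsBr⟩

/-- Twice the `½ℤ`-degree: `deg L_m = deg I_m = -m`, `deg G_r^± = -r`. -/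
def deg2 : NSI → ℤ
  | .L m => -(2 * m)
  | .I m => -(2 * m)
  | .G _ k => -(2 * k + 1)

namespace SuperData

lemma sg_comm (a b : ZMod 2) : sg a b = sg b a := by simp only [sg, mul_comm]

lemma sg_zero_left (a : ZMod 2) : sg 0 a = 1 := by simp [sg]

lemma sg_zero_right (a : ZMod 2) : sg a 0 = 1 := by simp [sg]

lemma sg_one_one : sg 1 1 = -1 := by simp [sg]

lemma zmod_two_cases (a : ZMod 2) : a = 0 ∨ a = 1 := by
  revert a; decide

lemma sg_add_left (a b c : ZMod 2) : sg (a + b) c = sg a c * sg b c := by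
  have h : (1 : ZMod 2) + 1 = 0 := by decide
  rcases zmod_two_cases a with rfl | rfl <;> rcases zmod_two_cases b with rfl | rfl <;>
    rcases zmod_two_cases c with rfl | rfl <;> simp [sg, h]

lemma sg_add_right (a b c : ZMod 2) : sg a (b + c) = sg a b * sg a c := by
  rw [sg_comm, sg_add_left, sg_comm b, sg_comm c]

lemma sg_mul_self (a b : ZMod 2) : sg a b * sg a b = 1 := by
  unfold sg; split_ifs <;> norm_num

section Lift

variable {α M : Type*} [AddCommGroup M] [Module ℂ M]

@[simp]
lemma lift_single (g : α → M) (a : α) (c : ℂ) : lift g (Finsupp.single a c) = c • g a := by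
  simp [lift]

lemma lift_apply (g : α → M) (v : α →₀ ℂ) : lift g v = v.sum fun a c => c • g a := by
  simp [lift, Finsupp.linearCombination_apply]

end Lift

variable {D : SuperData}

@[simp]
lemma lift_e {M : Type*} [AddCommGroup M] [Module ℂ M] (g : D.ι → M) (i : D.ι) :
    lift g (D.e i) = g i := by
  simp [e]

lemma brk_e_e (i j : D.ι) : D.brk (D.e i) (D.e j) = D.br i j := by simp [brk]

lemma tens2_e_e (i j : D.ι) : D.tens2 (D.e i) (D.e j) = Finsupp.single (i, j) 1 := by
  simp [tens2]

lemma tens3_e_e_e (i j k : D.ι) :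
    D.tens3 (D.e i) (D.e j) (D.e k) = Finsupp.single (i, j, k) 1 := by
  simp [tens3]

/-- Two linear maps out of `V` agree as soon as they agree on the basis. -/
lemma hom_ext {M : Type*} [AddCommGroup M] [Module ℂ M] {f g : D.V →ₗ[ℂ] M}
    (h : ∀ i, f (D.e i) = g (D.e i)) : f = g :=
  Finsupp.lhom_ext' fun i => LinearMap.ext_ring (h i)

lemma hom_ext_T2 {M : Type*} [AddCommGroup M] [Module ℂ M] {f g : D.T2 →ₗ[ℂ] M}
    (h : ∀ i j, f (D.tens2 (D.e i) (D.e j)) = g (D.tens2 (D.e i) (D.e j))) : f = g :=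
  Finsupp.lhom_ext' fun p => LinearMap.ext_ring (by simpa [tens2_e_e] using h p.1 p.2)

/-- The linear map multiplying a homogeneous element `v` by the Koszul sign of `a` and `v`. -/
def twist (D : SuperData) (a : ZMod 2) : D.V →ₗ[ℂ] D.V :=
  lift fun i => sg a (D.par i) • D.e i

@[simp]
lemma twist_e (a : ZMod 2) (i : D.ι) : D.twist a (D.e i) = sg a (D.par i) • D.e i := by
  simp [twist]

lemma twist_of_homog (a p : ZMod 2) {v : D.V} (hv : D.Homog1 p v) :
    D.twist a v = sg a p • v := by
  conv_rhs => rw [← Finsupp.sum_single v]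
  rw [twist, lift_apply, Finsupp.sum, Finsupp.sum, Finset.smul_sum]
  refine Finset.sum_congr rfl fun i hi => ?_
  rw [hv i hi, smul_comm]
  simp [e]

/-- The axioms of a Lie superalgebra, expressed on basis elements. -/
structure IsLieBasis (D : SuperData) : Prop where
  homog : ∀ i j, D.Homog1 (D.par i + D.par j) (D.br i j)
  skew : ∀ i j, D.br i j = -sg (D.par i) (D.par j) • D.br j i
  jacobi : ∀ i j k, D.brk (D.e i) (D.br j k) =
    D.brk (D.br i j) (D.e k) + sg (D.par i) (D.par j) • D.brk (D.e j) (D.br i k)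

lemma star2_e_tens2 (x : D.ι) (u v : D.V) :
    D.star2 (D.e x) (D.tens2 u v) =
      D.tens2 (D.brk (D.e x) u) v + D.tens2 (D.twist (D.par x) u) (D.brk (D.e x) v) := by
  have h : D.tens2.compr₂ (D.star2 (D.e x)) =
      D.tens2 ∘ₗ D.brk (D.e x) +
        (D.tens2.compl₂ (D.brk (D.e x))) ∘ₗ D.twist (D.par x) := by
    refine hom_ext fun i => hom_ext fun j => ?_
    simp [tens2_e_e, star2, brk_e_e]
  simpa using congrArg (fun f => f u v) h

lemma star3_e_tens3 (x : D.ι) (u v w : D.V) :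
    D.star3 (D.e x) (D.tens3 u v w) =
      D.tens3 (D.brk (D.e x) u) v w +
      D.tens3 (D.twist (D.par x) u) (D.brk (D.e x) v) w +
      D.tens3 (D.twist (D.par x) u) (D.twist (D.par x) v) (D.brk (D.e x) w) := by
  induction u using Finsupp.induction_linear with
  | zero => simp
  | add f g hf hg => simp only [map_add, LinearMap.add_apply, hf, hg]; abel
  | single i a =>
  induction v using Finsupp.induction_linear with
  | zero => simp
  | add f g hf hg => simp only [map_add, LinearMap.add_apply, hf, hg]; abel
  | single j b =>
  induction w using Finsupp.induction_linear with
  | zero => simp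
  | add f g hf hg => simp only [map_add, hf, hg]; abel
  | single k c =>
  have hs (i : D.ι) (a : ℂ) : Finsupp.single i a = a • D.e i := by simp [e]
  simp only [hs, map_smul, LinearMap.smul_apply, ← smul_add]
  congr 3
  simp [tens3_e_e_e, star3, brk_e_e, sg_add_right, smul_smul, mul_comm (sg _ (D.par i))]

lemma IsLieBasis.twist_br (hD : D.IsLieBasis) (a : ZMod 2) (i j : D.ι) :
    D.twist a (D.br i j) = (sg a (D.par i) * sg a (D.par j)) • D.br i j := by
  rw [twist_of_homog a _ (hD.homog i j), sg_add_right]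

lemma IsLieBasis.star2_br (hD : D.IsLieBasis) (x y : D.ι) (r : D.T2) :
    D.star2 (D.br x y) r = D.star2 (D.e x) (D.star2 (D.e y) r) -
      sg (D.par x) (D.par y) • D.star2 (D.e y) (D.star2 (D.e x) r) := by
  suffices h : D.star2 (D.br x y) = D.star2 (D.e x) ∘ₗ D.star2 (D.e y) -
      sg (D.par x) (D.par y) • D.star2 (D.e y) ∘ₗ D.star2 (D.e x) by
    simpa using congrArg (fun f => f r) h
  refine hom_ext_T2 fun i j => ?_
  have star_homog {p : ZMod 2} {z : D.V} (hz : D.Homog1 p z) :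
      D.star2 z (D.tens2 (D.e i) (D.e j)) = D.tens2 (D.brk z (D.e i)) (D.e j) +
        sg p (D.par i) • D.tens2 (D.e i) (D.brk z (D.e j)) := by
    have h1 : D.tens2 (D.brk z (D.e i)) (D.e j) + sg p (D.par i) •
        D.tens2 (D.e i) (D.brk z (D.e j)) = D.tens2 (D.brk z (D.e i)) (D.e j) +
        D.tens2 (D.e i) (D.brk (D.twist (D.par i) z) (D.e j)) := by
      rw [twist_of_homog _ _ hz, sg_comm]; simp
    rw [h1]
    have h : D.star2.flip (D.tens2 (D.e i) (D.e j)) =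
        D.tens2.flip (D.e j) ∘ₗ D.brk.flip (D.e i) +
        D.tens2 (D.e i) ∘ₗ D.brk.flip (D.e j) ∘ₗ D.twist (D.par i) := by
      refine hom_ext fun k => ?_
      simp [star2_e_tens2, brk_e_e, sg_comm]
    simpa using congrArg (fun f => f z) h
  rw [star_homog (hD.homog x y)]
  have hi := hD.jacobi x y i
  have hj := hD.jacobi x y j
  rw [← sub_eq_iff_eq_add] at hi hj
  simp only [LinearMap.sub_apply, LinearMap.comp_apply, LinearMap.smul_apply, star2_e_tens2,
    brk_e_e, twist_e, map_smul, map_add, hD.twist_br, sg_add_left, ← hi, ← hj, map_sub]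
  rcases zmod_two_cases (D.par x) with hx | hx <;>
    rcases zmod_two_cases (D.par y) with hy | hy <;>
    rcases zmod_two_cases (D.par i) with hi | hi <;>
    simp only [hx, hy, hi, sg_zero_left, sg_zero_right, sg_one_one] <;> module

section YangBaxter

/-- The bilinear extension of `[r¹², s²³]`. -/
def ybX (D : SuperData) : D.T2 →ₗ[ℂ] D.T2 →ₗ[ℂ] D.T3 :=
  lift fun p => lift fun q => D.tens3 (D.e p.1) (D.br p.2 q.1) (D.e q.2)

/-- The bilinear extension of `[r¹³, s²³]`. -/
def ybY (D : SuperData) : D.T2 →ₗ[ℂ] D.T2 →ₗ[ℂ] D.T3 :=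
  lift fun p => lift fun q =>
    sg (D.par q.1) (D.par p.2) • D.tens3 (D.e p.1) (D.e q.1) (D.br p.2 q.2)

/-- The bilinear extension of `[r¹², s¹³]`. -/
def ybZ (D : SuperData) : D.T2 →ₗ[ℂ] D.T2 →ₗ[ℂ] D.T3 :=
  lift fun p => lift fun q =>
    sg (D.par q.1) (D.par p.2) • D.tens3 (D.br p.1 q.1) (D.e p.2) (D.e q.2)

lemma cybe_eq (r : D.T2) : D.cybe r = D.ybX r r + D.ybY r r + D.ybZ r r := by
  simp only [cybe, ybX, ybY, ybZ, lift_apply, Finsupp.sum, LinearMap.sum_apply,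
    LinearMap.smul_apply, ← Finset.sum_add_distrib]
  refine Finset.sum_congr rfl fun p _ => ?_
  simp only [Finset.smul_sum, ← Finset.sum_add_distrib]
  refine Finset.sum_congr rfl fun q _ => ?_
  module

@[simp]
lemma ybX_tens2 (u v w z : D.V) :
    D.ybX (D.tens2 u v) (D.tens2 w z) = D.tens3 u (D.brk v w) z := by
  have hs (i : D.ι) (a : ℂ) : Finsupp.single i a = a • D.e i := by simp [e]
  induction u using Finsupp.induction_linear with
  | zero => simp
  | add f g hf hg => simp only [map_add, LinearMap.add_apply, hf, hg]
  | single i a =>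
  induction v using Finsupp.induction_linear with
  | zero => simp
  | add f g hf hg => simp only [map_add, LinearMap.add_apply, hf, hg]
  | single j b =>
  induction w using Finsupp.induction_linear with
  | zero => simp
  | add f g hf hg => simp only [map_add, LinearMap.add_apply, hf, hg]
  | single k c =>
  induction z using Finsupp.induction_linear with
  | zero => simp
  | add f g hf hg => simp only [map_add, hf, hg]
  | single l d =>
    have h : D.ybX (D.tens2 (D.e i) (D.e j)) (D.tens2 (D.e k) (D.e l)) =
        D.tens3 (D.e i) (D.br j k) (D.e l) := by simp [tens2_e_e, ybX]
    simp only [hs, map_smul, LinearMap.smul_apply, h, brk_e_e]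

lemma ybY_tens2_right (u : D.V) (b : D.ι) (w z : D.V) :
    D.ybY (D.tens2 u (D.e b)) (D.tens2 w z) =
      D.tens3 u (D.twist (D.par b) w) (D.brk (D.e b) z) := by
  have hs (i : D.ι) (a : ℂ) : Finsupp.single i a = a • D.e i := by simp [e]
  induction u using Finsupp.induction_linear with
  | zero => simp
  | add f g hf hg => simp only [map_add, LinearMap.add_apply, hf, hg]
  | single i a =>
  induction w using Finsupp.induction_linear with
  | zero => simp
  | add f g hf hg => simp only [map_add, LinearMap.add_apply, hf, hg]
  | single k c =>
  induction z using Finsupp.induction_linear with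
  | zero => simp
  | add f g hf hg => simp only [map_add, hf, hg]
  | single l d =>
    have h : D.ybY (D.tens2 (D.e i) (D.e b)) (D.tens2 (D.e k) (D.e l)) =
        sg (D.par b) (D.par k) • D.tens3 (D.e i) (D.e k) (D.br b l) := by
      simp [tens2_e_e, ybY, sg_comm]
    simp only [hs, map_smul, LinearMap.smul_apply, h, brk_e_e, twist_e]
    module

lemma ybY_tens2_left (u v : D.V) (c : D.ι) (z : D.V) :
    D.ybY (D.tens2 u v) (D.tens2 (D.e c) z) =
      D.tens3 u (D.e c) (D.brk (D.twist (D.par c) v) z) := by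
  induction v using Finsupp.induction_linear with
  | zero => simp
  | add f g hf hg => simp only [map_add, LinearMap.add_apply, hf, hg]
  | single j b =>
  have hs (i : D.ι) (a : ℂ) : Finsupp.single i a = a • D.e i := by simp [e]
  simp [hs, ybY_tens2_right, sg_comm]

lemma ybZ_tens2_right (u : D.V) (b : D.ι) (w z : D.V) :
    D.ybZ (D.tens2 u (D.e b)) (D.tens2 w z) =
      D.tens3 (D.brk u (D.twist (D.par b) w)) (D.e b) z := by
  have hs (i : D.ι) (a : ℂ) : Finsupp.single i a = a • D.e i := by simp [e]
  induction u using Finsupp.induction_linear with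
  | zero => simp
  | add f g hf hg => simp only [map_add, LinearMap.add_apply, hf, hg]
  | single i a =>
  induction w using Finsupp.induction_linear with
  | zero => simp
  | add f g hf hg => simp only [map_add, LinearMap.add_apply, hf, hg]
  | single k c =>
  induction z using Finsupp.induction_linear with
  | zero => simp
  | add f g hf hg => simp only [map_add, hf, hg]
  | single l d =>
    have h : D.ybZ (D.tens2 (D.e i) (D.e b)) (D.tens2 (D.e k) (D.e l)) =
        sg (D.par b) (D.par k) • D.tens3 (D.br i k) (D.e b) (D.e l) := by
      simp [tens2_e_e, ybZ, sg_comm]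
    simp only [hs, map_smul, LinearMap.smul_apply, h, brk_e_e, twist_e]
    module

lemma ybZ_tens2_left (u v : D.V) (c : D.ι) (z : D.V) :
    D.ybZ (D.tens2 u v) (D.tens2 (D.e c) z) =
      D.tens3 (D.brk u (D.e c)) (D.twist (D.par c) v) z := by
  induction v using Finsupp.induction_linear with
  | zero => simp
  | add f g hf hg => simp only [map_add, LinearMap.add_apply, hf, hg]
  | single j b =>
  have hs (i : D.ι) (a : ℂ) : Finsupp.single i a = a • D.e i := by simp [e]
  simp [hs, ybZ_tens2_right, sg_comm]

lemma bilin_ext_even {M : Type*} [AddCommGroup M] [Module ℂ M]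
    {F G : D.T2 →ₗ[ℂ] D.T2 →ₗ[ℂ] M}
    (h : ∀ a b c d, D.par a + D.par b = 0 →
      F (D.tens2 (D.e a) (D.e b)) (D.tens2 (D.e c) (D.e d)) =
        G (D.tens2 (D.e a) (D.e b)) (D.tens2 (D.e c) (D.e d)))
    {r : D.T2} (hr : D.IsEven2 r) (s : D.T2) : F r s = G r s := by
  rw [← Finsupp.sum_single r, Finsupp.sum, map_sum, map_sum, LinearMap.sum_apply,
    LinearMap.sum_apply]
  refine Finset.sum_congr rfl fun p hp => ?_
  refine congrArg (fun f => f s) (hom_ext_T2 (f := F _) (g := G _) fun c d => ?_)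
  have := h p.1 p.2 c d (hr p hp)
  rw [tens2_e_e] at this
  rw [← mul_one (r p), ← smul_eq_mul, ← Finsupp.smul_single]
  simp only [map_smul, LinearMap.smul_apply, this]

variable (hD : D.IsLieBasis)
include hD

lemma IsLieBasis.star3_ybX (x : D.ι) {r : D.T2} (hr : D.IsEven2 r) (s : D.T2) :
    D.star3 (D.e x) (D.ybX r s) =
      D.ybX (D.star2 (D.e x) r) s + D.ybX r (D.star2 (D.e x) s) := by
  refine bilin_ext_even (F := D.ybX.compr₂ (D.star3 (D.e x)))
    (G := D.ybX ∘ₗ D.star2 (D.e x) + D.ybX.compl₂ (D.star2 (D.e x))) ?_ hr s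
  intro a b c d hab
  have hab' : D.par a = D.par b := by
    rw [← sub_eq_zero, CharTwo.sub_eq_add, hab]
  simp only [LinearMap.compr₂_apply, LinearMap.add_apply, LinearMap.comp_apply,
    LinearMap.compl₂_apply, star2_e_tens2, map_add, ybX_tens2, star3_e_tens3, brk_e_e, twist_e,
    map_smul, LinearMap.smul_apply, hD.twist_br, hD.jacobi x b c, hab', smul_smul, mul_assoc,
    sg_mul_self]
  rcases zmod_two_cases (D.par x) with hx | hx <;>
    rcases zmod_two_cases (D.par b) with hb | hb <;>
    simp only [hx, hb, sg_zero_left, sg_zero_right, sg_one_one] <;> module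

lemma IsLieBasis.star3_ybY (x : D.ι) {r : D.T2} (hr : D.IsEven2 r) (s : D.T2) :
    D.star3 (D.e x) (D.ybY r s) =
      D.ybY (D.star2 (D.e x) r) s + D.ybY r (D.star2 (D.e x) s) := by
  refine bilin_ext_even (F := D.ybY.compr₂ (D.star3 (D.e x)))
    (G := D.ybY ∘ₗ D.star2 (D.e x) + D.ybY.compl₂ (D.star2 (D.e x))) ?_ hr s
  intro a b c d hab
  have hab' : D.par a = D.par b := by
    rw [← sub_eq_zero, CharTwo.sub_eq_add, hab]
  simp only [LinearMap.compr₂_apply, LinearMap.add_apply, LinearMap.comp_apply,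
    LinearMap.compl₂_apply, star2_e_tens2, map_add, ybY_tens2_left _ (D.br _ _),
    ybY_tens2_right, star3_e_tens3, brk_e_e, twist_e,
    map_smul, LinearMap.smul_apply, hD.twist_br, hD.jacobi x b d, hab', smul_smul,
    smul_add]
  rcases zmod_two_cases (D.par x) with hx | hx <;>
    rcases zmod_two_cases (D.par b) with hb | hb <;>
    rcases zmod_two_cases (D.par c) with hc | hc <;>
    simp only [hx, hb, hc, sg_zero_left, sg_zero_right, sg_one_one] <;> module

lemma IsLieBasis.star3_ybZ (x : D.ι) {r : D.T2} (hr : D.IsEven2 r) (s : D.T2) :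
    D.star3 (D.e x) (D.ybZ r s) =
      D.ybZ (D.star2 (D.e x) r) s + D.ybZ r (D.star2 (D.e x) s) := by
  refine bilin_ext_even (F := D.ybZ.compr₂ (D.star3 (D.e x)))
    (G := D.ybZ ∘ₗ D.star2 (D.e x) + D.ybZ.compl₂ (D.star2 (D.e x))) ?_ hr s
  intro a b c d hab
  have hab' : D.par a = D.par b := by
    rw [← sub_eq_zero, CharTwo.sub_eq_add, hab]
  simp only [LinearMap.compr₂_apply, LinearMap.add_apply, LinearMap.comp_apply,
    LinearMap.compl₂_apply, star2_e_tens2, map_add, ybZ_tens2_left _ (D.br _ _),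
    ybZ_tens2_right, star3_e_tens3, brk_e_e, twist_e,
    map_smul, LinearMap.smul_apply, hD.twist_br, hD.jacobi x a c, hab', smul_smul,
    smul_add]
  rcases zmod_two_cases (D.par x) with hx | hx <;>
    rcases zmod_two_cases (D.par b) with hb | hb <;>
    rcases zmod_two_cases (D.par c) with hc | hc <;>
    simp only [hx, hb, hc, sg_zero_left, sg_zero_right, sg_one_one] <;> module

omit hD in
lemma xi_tens3 (a d : D.ι) (u : D.V) :
    D.xi (D.tens3 (D.e a) u (D.e d)) =
      sg (D.par a) (D.par d) • D.tens3 (D.twist (D.par a) u) (D.e d) (D.e a) := by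
  have hs (i : D.ι) (a : ℂ) : Finsupp.single i a = a • D.e i := by simp [e]
  induction u using Finsupp.induction_linear with
  | zero => simp
  | add f g hf hg => simp only [map_add, LinearMap.add_apply, hf, hg, smul_add]
  | single j b =>
  have h : D.xi (D.tens3 (D.e a) (D.e j) (D.e d)) =
      (sg (D.par a) (D.par d) * sg (D.par a) (D.par j)) • D.tens3 (D.e j) (D.e d) (D.e a) := by
    simp [tens3_e_e_e, xi, sg_add_right, mul_comm]
  simp only [hs, map_smul, LinearMap.smul_apply, h, twist_e]
  module

omit hD in
lemma xi_tens3' (a d : D.ι) (u : D.V) :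
    D.xi (D.tens3 u (D.e d) (D.e a)) =
      D.tens3 (D.e d) (D.e a) (D.twist (D.par d + D.par a) u) := by
  have hs (i : D.ι) (a : ℂ) : Finsupp.single i a = a • D.e i := by simp [e]
  induction u using Finsupp.induction_linear with
  | zero => simp
  | add f g hf hg => simp only [map_add, LinearMap.add_apply, hf, hg]
  | single j b => simp [hs, tens3_e_e_e, xi, sg_comm, mul_comm]

omit hD in
lemma xi_xi_xi (t : D.T3) : D.xi (D.xi (D.xi t)) = t := by
  suffices h : D.xi ∘ₗ D.xi ∘ₗ D.xi = LinearMap.id from congrArg (fun f => f t) h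
  refine Finsupp.lhom_ext' fun p => LinearMap.ext_ring ?_
  rcases zmod_two_cases (D.par p.1) with hx | hx <;>
    rcases zmod_two_cases (D.par p.2.1) with hy | hy <;>
    rcases zmod_two_cases (D.par p.2.2) with hz | hz <;>
    simp [xi, hx, hy, hz, sg_zero_left, sg_zero_right, sg_one_one, CharTwo.add_self_eq_zero]

omit hD in
@[simp]
lemma tau_tens2 (a b : D.ι) : D.tau (D.tens2 (D.e a) (D.e b)) =
    sg (D.par a) (D.par b) • D.tens2 (D.e b) (D.e a) := by
  simp [tens2_e_e, tau]

lemma IsLieBasis.xi_ybX {r : D.T2} (hr : D.IsEven2 r) (hr' : D.tau r = -r) (s : D.T2) :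
    D.xi (D.ybX r s) = D.ybZ s r := by
  have h : D.ybZ s r = -D.ybZ s (D.tau r) := by rw [hr', map_neg, neg_neg]
  rw [h, ← neg_one_smul ℂ]
  refine bilin_ext_even (F := D.ybX.compr₂ D.xi) (G := (-1 : ℂ) • D.ybZ.flip ∘ₗ D.tau) ?_ hr s
  intro a b c d hab
  have hab' : D.par a = D.par b := by
    rw [← sub_eq_zero, CharTwo.sub_eq_add, hab]
  simp only [LinearMap.compr₂_apply, LinearMap.comp_apply, tau_tens2,
    map_smul, LinearMap.smul_apply, LinearMap.flip_apply, ybX_tens2, ybZ_tens2_right, xi_tens3,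
    brk_e_e, hD.twist_br, twist_e, hab', hD.skew c b, smul_smul]
  rcases zmod_two_cases (D.par b) with hb | hb <;>
    rcases zmod_two_cases (D.par c) with hc | hc <;>
    rcases zmod_two_cases (D.par d) with hd | hd <;>
    simp [hb, hc, hd, sg_zero_left, sg_zero_right, sg_one_one]

lemma IsLieBasis.xi_ybX' {r : D.T2} (hr : D.IsEven2 r) (s : D.T2) (hs : D.tau s = -s) :
    D.xi (D.ybX s r) = D.ybZ r s := by
  have h : D.ybZ r s = -D.ybZ r (D.tau s) := by rw [hs, map_neg, neg_neg]
  rw [h, ← neg_one_smul ℂ]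
  refine bilin_ext_even (F := D.ybX.flip.compr₂ D.xi) (G := (-1 : ℂ) • (D.ybZ.compl₂ D.tau)) ?_ hr s
  intro c d a b hcd
  have hcd' : D.par d = D.par c := by
    rw [← sub_eq_zero, CharTwo.sub_eq_add, add_comm, hcd]
  simp only [LinearMap.compr₂_apply, LinearMap.compl₂_apply, tau_tens2,
    map_smul, LinearMap.smul_apply, LinearMap.flip_apply, ybX_tens2, ybZ_tens2_right, xi_tens3,
    brk_e_e, hD.twist_br, twist_e, hcd', hD.skew c b, smul_smul]
  rcases zmod_two_cases (D.par b) with hb | hb <;>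
    rcases zmod_two_cases (D.par c) with hc | hc <;>
    rcases zmod_two_cases (D.par a) with hd | hd <;>
    simp [hb, hc, hd, sg_zero_left, sg_zero_right, sg_one_one]

lemma IsLieBasis.xi_xi_ybX {r : D.T2} (hr : D.IsEven2 r) (s : D.T2) (hs : D.tau s = -s) :
    D.xi (D.xi (D.ybX r s)) = D.ybY s r := by
  have h : D.ybY s r = -D.ybY (D.tau s) r := by
    rw [hs, map_neg, LinearMap.neg_apply, neg_neg]
  rw [h, ← neg_one_smul ℂ]
  refine bilin_ext_even (F := D.ybX.compr₂ (D.xi ∘ₗ D.xi)) (G := (-1 : ℂ) • (D.ybY.flip.compl₂ D.tau))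
    ?_ hr s
  intro a b c d hab
  have hab' : D.par a = D.par b := by
    rw [← sub_eq_zero, CharTwo.sub_eq_add, hab]
  simp only [LinearMap.compr₂_apply, LinearMap.comp_apply, tau_tens2,
    LinearMap.compl₂_apply, map_smul, LinearMap.smul_apply, LinearMap.flip_apply, ybX_tens2,
    ybY_tens2_right, xi_tens3, xi_tens3',
    brk_e_e, hD.twist_br, twist_e, hab', hD.skew c b, smul_smul, sg_add_left]
  rcases zmod_two_cases (D.par b) with hb | hb <;>
    rcases zmod_two_cases (D.par c) with hc | hc <;>
    rcases zmod_two_cases (D.par d) with hd | hd <;>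
    simp [hb, hc, hd, sg_zero_left, sg_zero_right, sg_one_one]

lemma IsLieBasis.xi_xi_ybX' {r : D.T2} (hr : D.IsEven2 r) (hr' : D.tau r = -r) (s : D.T2) :
    D.xi (D.xi (D.ybX s r)) = D.ybY r s := by
  have h : D.ybY r s = -D.ybY (D.tau r) s := by
    rw [hr', map_neg, LinearMap.neg_apply, neg_neg]
  rw [h, ← neg_one_smul ℂ]
  refine bilin_ext_even (F := D.ybX.flip.compr₂ (D.xi ∘ₗ D.xi)) (G := (-1 : ℂ) • (D.ybY ∘ₗ D.tau))
    ?_ hr s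
  intro c d a b hcd
  have hcd' : D.par d = D.par c := by
    rw [← sub_eq_zero, CharTwo.sub_eq_add, add_comm, hcd]
  simp only [LinearMap.compr₂_apply, LinearMap.comp_apply, tau_tens2,
    map_smul, LinearMap.smul_apply, LinearMap.flip_apply, ybX_tens2,
    ybY_tens2_right, xi_tens3, xi_tens3',
    brk_e_e, hD.twist_br, twist_e, hcd', hD.skew c b, smul_smul, sg_add_left]
  rcases zmod_two_cases (D.par b) with hb | hb <;>
    rcases zmod_two_cases (D.par c) with hc | hc <;>
    rcases zmod_two_cases (D.par a) with hd | hd <;>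
    simp [hb, hc, hd, sg_zero_left, sg_zero_right, sg_one_one]

lemma IsLieBasis.tau_star2 (x : D.ι) (r : D.T2) :
    D.tau (D.star2 (D.e x) r) = D.star2 (D.e x) (D.tau r) := by
  have h1 (u : D.V) (b : D.ι) :
      D.tau (D.tens2 u (D.e b)) = D.tens2 (D.e b) (D.twist (D.par b) u) := by
    suffices h : D.tau ∘ₗ D.tens2.flip (D.e b) = D.tens2 (D.e b) ∘ₗ D.twist (D.par b) from
      congrArg (fun f => f u) h
    refine hom_ext fun i => ?_
    simp [sg_comm]
  have h2 (u : D.V) (a : D.ι) :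
      D.tau (D.tens2 (D.e a) u) = D.tens2 (D.twist (D.par a) u) (D.e a) := by
    suffices h : D.tau ∘ₗ D.tens2 (D.e a) = D.tens2.flip (D.e a) ∘ₗ D.twist (D.par a) from
      congrArg (fun f => f u) h
    refine hom_ext fun i => ?_
    simp
  suffices h : D.tau ∘ₗ D.star2 (D.e x) = D.star2 (D.e x) ∘ₗ D.tau from
    congrArg (fun f => f r) h
  refine hom_ext_T2 fun a b => ?_
  simp only [LinearMap.comp_apply, star2_e_tens2, map_add, map_smul, twist_e, brk_e_e,
    LinearMap.smul_apply, h1, h2, hD.twist_br]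
  rcases zmod_two_cases (D.par b) with hb | hb <;>
    rcases zmod_two_cases (D.par a) with ha | ha <;>
    rcases zmod_two_cases (D.par x) with hd | hd <;>
    simp [hb, ha, hd, sg_zero_left, sg_zero_right, sg_one_one, add_comm]

omit hD in
lemma oneDelta_flip_star2 (r s : D.T2) :
    D.oneDelta (D.star2.flip r) s = D.ybX s r + D.ybY s r := by
  have key (a : D.ι) (u v : D.V) :
      Finsupp.mapDomain (fun q : D.ι × D.ι => (a, q.1, q.2)) (D.tens2 u v) =
        D.tens3 (D.e a) u v := by
    suffices h : D.tens2.compr₂ (Finsupp.lmapDomain ℂ ℂ fun q : D.ι × D.ι => (a, q.1, q.2)) =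
        D.tens3 (D.e a) by
      simpa using congrArg (fun f => f u v) h
    refine hom_ext fun i => hom_ext fun j => ?_
    simp [tens2_e_e, tens3_e_e_e, Finsupp.mapDomain_single]
  have key2 (a b : D.ι) :
      Finsupp.lmapDomain ℂ ℂ (fun q : D.ι × D.ι => (a, q.1, q.2)) ∘ₗ D.star2 (D.e b) =
        D.ybX (D.tens2 (D.e a) (D.e b)) + D.ybY (D.tens2 (D.e a) (D.e b)) := by
    refine hom_ext_T2 fun c d => ?_
    simp [star2_e_tens2, brk_e_e, Finsupp.mapDomain_add, Finsupp.mapDomain_smul, key,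
      ybY_tens2_right]
  suffices h : D.oneDelta (D.star2.flip r) = D.ybX.flip r + D.ybY.flip r by
    simpa using congrArg (fun f => f s) h
  refine hom_ext_T2 fun a b => ?_
  have := congrArg (fun f => f r) (key2 a b)
  simpa [oneDelta, tens2_e_e] using this

/-- For an even skew-symmetric `r`, the co-Jacobi expression of the coboundary `x ↦ x ∗ r` is the
action of `x` on the Yang–Baxter expression of `r`. -/
theorem IsLieBasis.coJacobi_eq_star3_cybe (x : D.ι) {r : D.T2} (hr : D.IsEven2 r)
    (hr' : D.tau r = -r) :
    D.oneDelta (D.star2.flip r) (D.star2 (D.e x) r) +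
      D.xi (D.oneDelta (D.star2.flip r) (D.star2 (D.e x) r)) +
      D.xi (D.xi (D.oneDelta (D.star2.flip r) (D.star2 (D.e x) r))) =
    D.star3 (D.e x) (D.cybe r) := by
  set s := D.star2 (D.e x) r with hs
  have hs' : D.tau s = -s := by rw [hs, hD.tau_star2, hr', map_neg]
  have h1 := hD.xi_ybX hr hr' s
  have h2 := hD.xi_ybX' hr s hs'
  have h3 := hD.xi_xi_ybX hr s hs'
  have h4 := hD.xi_xi_ybX' hr hr' s
  have h5 := xi_xi_xi (D.ybX r s)
  rw [oneDelta_flip_star2, cybe_eq, map_add (D.star3 _), map_add (D.star3 _), hD.star3_ybX x hr, hD.star3_ybY x hr,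
    hD.star3_ybZ x hr, ← hs, map_add, map_add, h2, ← h3, h5, ← h1, ← h4, ← h2]
  abel

end YangBaxter

section Coordinates

variable {D : SuperData} {ad : D.ι → (D.ι → ℂ) →ₗ[ℂ] (D.ι → ℂ)}

/-- `ad` describes the adjoint action of basis elements on coordinate functions. -/
def IsCoordAd (D : SuperData) (ad : D.ι → (D.ι → ℂ) →ₗ[ℂ] (D.ι → ℂ)) : Prop :=
  ∀ x j, ⇑(D.br x j) = ad x (D.e j)

lemma IsCoordAd.brk (h : D.IsCoordAd ad) (x : D.ι) (v : D.V) : ⇑(D.brk (D.e x) v) = ad x v := by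
  have : (Finsupp.lcoeFun (R := ℂ)) ∘ₗ D.brk (D.e x) = ad x ∘ₗ Finsupp.lcoeFun :=
    hom_ext fun j => by simpa [brk_e_e] using h x j
  simpa using congrArg (fun f => f v) this

lemma tens2_apply (u v : D.V) (i j : D.ι) : D.tens2 u v (i, j) = u i * v j := by
  induction u using Finsupp.induction_linear with
  | zero => simp
  | add f g hf hg => simp [hf, hg, add_mul]
  | single k a =>
  induction v using Finsupp.induction_linear with
  | zero => simp
  | add f g hf hg => simp [hf, hg, mul_add]
  | single l b =>
  simp only [tens2, lift_single, LinearMap.smul_apply, Finsupp.smul_apply]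
  classical
  simp only [Finsupp.single_apply, Prod.mk.injEq, smul_eq_mul]
  split_ifs <;> simp_all

lemma tens3_apply (u v w : D.V) (i j k : D.ι) : D.tens3 u v w (i, j, k) = u i * v j * w k := by
  induction u using Finsupp.induction_linear with
  | zero => simp
  | add f g hf hg => simp [hf, hg, add_mul]
  | single i' a =>
  induction v using Finsupp.induction_linear with
  | zero => simp
  | add f g hf hg => simp [hf, hg, mul_add, add_mul]
  | single j' b =>
  induction w using Finsupp.induction_linear with
  | zero => simp
  | add f g hf hg => simp [hf, hg, mul_add]
  | single k' c =>
  simp only [tens3, lift_single, LinearMap.smul_apply, Finsupp.smul_apply]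
  classical
  simp only [Finsupp.single_apply, Prod.mk.injEq, smul_eq_mul]
  split_ifs <;> simp_all [mul_assoc]

lemma IsCoordAd.star2_apply (h : D.IsCoordAd ad) (x : D.ι) (v : D.T2) (i j : D.ι) :
    D.star2 (D.e x) v (i, j) = ad x (fun k => v (k, j)) i +
      sg (D.par x) (D.par i) * ad x (fun k => v (i, k)) j := by
  have hs (u w : D.V) (k) : (fun l => D.tens2 u w (l, k)) = w k • ⇑u := by
    ext l; rw [tens2_apply, mul_comm]; rfl
  have hs' (u w : D.V) (k) : (fun l => D.tens2 u w (k, l)) = u k • ⇑w := by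
    ext l; rw [tens2_apply]; rfl
  induction v using Finsupp.induction_linear with
  | zero =>
    change D.star2 (D.e x) 0 (i, j) = ad x 0 i + _ * ad x 0 j
    simp
  | add f g hf hg =>
    have e1 : (fun k => (f + g) (k, j)) = (fun k => f (k, j)) + fun k => g (k, j) := rfl
    have e2 : (fun k => (f + g) (i, k)) = (fun k => f (i, k)) + fun k => g (i, k) := rfl
    rw [e1, e2, map_add, Finsupp.add_apply, hf, hg, map_add, map_add]
    simp only [Pi.add_apply]; ring
  | single p a =>
    obtain ⟨k, l⟩ := p
    have hp : Finsupp.single (k, l) a = D.tens2 (a • D.e k) (D.e l) := by simp [tens2_e_e]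
    rw [hp, star2_e_tens2, Finsupp.add_apply, tens2_apply, tens2_apply, hs, hs', h.brk, h.brk]
    simp only [map_smul, twist_e, Pi.smul_apply, smul_eq_mul, Finsupp.smul_apply]
    rw [mul_comm (ad x _ i)]
    congr 1
    by_cases hki : k = i
    · subst hki; ring
    · simp [e, Finsupp.single_eq_of_ne (Ne.symm hki)]

lemma IsCoordAd.star3_apply (h : D.IsCoordAd ad) (x : D.ι) (v : D.T3) (i j k : D.ι) :
    D.star3 (D.e x) v (i, j, k) = ad x (fun l => v (l, j, k)) i +
      sg (D.par x) (D.par i) * ad x (fun l => v (i, l, k)) j +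
      sg (D.par x) (D.par i) * sg (D.par x) (D.par j) * ad x (fun l => v (i, j, l)) k := by
  have h1 (u w z : D.V) (j k) : (fun l => D.tens3 u w z (l, j, k)) = (w j * z k) • ⇑u := by
    ext l; rw [tens3_apply, Pi.smul_apply, smul_eq_mul]; ring
  have h2 (u w z : D.V) (i k) : (fun l => D.tens3 u w z (i, l, k)) = (u i * z k) • ⇑w := by
    ext l; rw [tens3_apply, Pi.smul_apply, smul_eq_mul]; ring
  have h3 (u w z : D.V) (i j) : (fun l => D.tens3 u w z (i, j, l)) = (u i * w j) • ⇑z := by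
    ext l; rw [tens3_apply, Pi.smul_apply, smul_eq_mul]
  induction v using Finsupp.induction_linear with
  | zero =>
    change D.star3 (D.e x) 0 (i, j, k) = ad x 0 i + _ * ad x 0 j + _ * ad x 0 k
    simp
  | add f g hf hg =>
    have e1 : (fun l => (f + g) (l, j, k)) = (fun l => f (l, j, k)) + fun l => g (l, j, k) := rfl
    have e2 : (fun l => (f + g) (i, l, k)) = (fun l => f (i, l, k)) + fun l => g (i, l, k) := rfl
    have e3 : (fun l => (f + g) (i, j, l)) = (fun l => f (i, j, l)) + fun l => g (i, j, l) := rfl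
    rw [e1, e2, e3, map_add, Finsupp.add_apply, hf, hg, map_add, map_add, map_add]
    simp only [Pi.add_apply]; ring
  | single p a =>
    obtain ⟨i', j', k'⟩ := p
    have hp : Finsupp.single (i', j', k') a = D.tens3 (a • D.e i') (D.e j') (D.e k') := by
      simp [tens3_e_e_e]
    rw [hp, star3_e_tens3, Finsupp.add_apply, Finsupp.add_apply, tens3_apply, tens3_apply,
      tens3_apply, h1, h2, h3, h.brk, h.brk, h.brk]
    simp only [map_smul, twist_e, Pi.smul_apply, smul_eq_mul, Finsupp.smul_apply]
    congr 1; congr 1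
    · ring
    · by_cases hi : i' = i
      · subst hi; ring
      · simp [e, Finsupp.single_eq_of_ne (Ne.symm hi)]
    · by_cases hi : i' = i
      · subst hi
        by_cases hj : j' = j
        · subst hj; ring
        · simp [e, Finsupp.single_eq_of_ne (Ne.symm hj)]
      · simp [e, Finsupp.single_eq_of_ne (Ne.symm hi)]

lemma IsCoordAd.jacobi (h : D.IsCoordAd ad) (hop : ∀ i j f, lift ad (D.br i j) f =
    ad i (ad j f) - sg (D.par i) (D.par j) • ad j (ad i f)) (i j k : D.ι) :
    D.brk (D.e i) (D.br j k) =
      D.brk (D.br i j) (D.e k) + sg (D.par i) (D.par j) • D.brk (D.e j) (D.br i k) := by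
  have h' : (Finsupp.lcoeFun (R := ℂ)) ∘ₗ D.brk.flip (D.e k) =
      (LinearMap.applyₗ (⇑(D.e k))) ∘ₗ lift ad :=
    hom_ext fun j => by simpa [brk_e_e] using h j k
  have h'' : ⇑(D.brk (D.br i j) (D.e k)) = lift ad (D.br i j) (D.e k) := by
    simpa using congrArg (fun f => f (D.br i j)) h'
  apply DFunLike.coe_injective
  simp only [Finsupp.coe_add, Finsupp.coe_smul, h.brk, h'', hop, h j k, h i k]
  abel

end Coordinates

lemma tau_tau {D : SuperData} (t : D.T2) : D.tau (D.tau t) = t := by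
  suffices h : D.tau ∘ₗ D.tau = LinearMap.id from congrArg (fun f => f t) h
  refine hom_ext_T2 fun i j => ?_
  simp [tau_tens2, smul_smul, sg_comm (D.par j), sg_mul_self]

lemma tau_of_mem_ImSkew {D : SuperData} {t : D.T2} (h : t ∈ D.ImSkew) : D.tau t = -t := by
  obtain ⟨u, rfl⟩ := h
  simp [tau_tau]

lemma mem_ImSkew_of_tau {D : SuperData} {t : D.T2} (h : D.tau t = -t) : t ∈ D.ImSkew :=
  ⟨(1 / 2 : ℂ) • t, by
    simp only [LinearMap.sub_apply, LinearMap.id_apply, map_smul, h]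
    module⟩

end SuperData

namespace NSd

/-- The sign of the `U(1)`-charge of `G^±`. -/
def eps (s : Bool) : ℂ := if s then 1 else -1

/-- The adjoint action of a basis element on coordinate functions. -/
def adf : NSI → (NSI → ℂ) → NSI → ℂ
  | .L n, f, .L a => (2 * (n : ℂ) - a) * f (.L (a - n))
  | .L n, f, .I a => ((n : ℂ) - a) * f (.I (a - n))
  | .L n, f, .G s a => ((3 * (n : ℂ) - 2 * a - 1) / 2) * f (.G s (a - n))
  | .I _, _, .L _ => 0
  | .I n, f, .I a => n * f (.L (a - n))
  | .I n, f, .G s a => eps s * f (.G s (a - n))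
  | .G s k, f, .L a => 2 * f (.G (!s) (a - k - 1))
  | .G s k, f, .I a => eps s * (2 * (k : ℂ) + 1 - a) * f (.G (!s) (a - k - 1))
  | .G s k, f, .G t a => if s = t then
      -(((a : ℂ) - 3 * k - 1) / 2) * f (.L (a - k)) - eps s * f (.I (a - k)) else 0

lemma adf_add (x : NSI) (f g : NSI → ℂ) (i : NSI) :
    adf x (fun p => f p + g p) i = adf x f i + adf x g i := by
  rcases x with n | n | ⟨s, n⟩ <;> rcases i with a | a | ⟨t, a⟩ <;> simp only [adf] <;>
    try split_ifs
  all_goals try ring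

lemma adf_smul (x : NSI) (c : ℂ) (f : NSI → ℂ) (i : NSI) :
    adf x (fun p => c * f p) i = c * adf x f i := by
  rcases x with n | n | ⟨s, n⟩ <;> rcases i with a | a | ⟨t, a⟩ <;> simp only [adf] <;>
    try split_ifs
  all_goals ring

@[simp]
lemma adf_zero (x : NSI) (i : NSI) : adf x (fun _ => 0) i = 0 := by
  simpa using adf_smul x 0 (fun _ => 0) i

lemma nsBr_apply (x j i : NSI) : nsBr x j i = adf x (fun p => Finsupp.single j (1 : ℂ) p) i := by
  have h1 (n m a : ℤ) : m = a - n ↔ n + m = a := by omega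
  rcases x with n | n | ⟨_ | _, n⟩ <;> rcases j with m | m | ⟨_ | _, m⟩ <;>
    rcases i with a | a | ⟨_ | _, a⟩ <;>
    simp [nsBr, adf, Finsupp.single_apply, eps, h1, add_comm m n, add_comm m 1,
      add_assoc]
  all_goals try split_ifs with h
  all_goals try subst h
  all_goals try push_cast
  all_goals ring

/-- `adf x` as a linear map. -/
def adLin (x : NSI) : (NSI → ℂ) →ₗ[ℂ] (NSI → ℂ) where
  toFun := adf x
  map_add' f g := funext (adf_add x f g)
  map_smul' c f := funext (adf_smul x c f)

lemma isCoordAd : NSd.IsCoordAd adLin := fun x j => funext fun i => nsBr_apply x j i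

lemma lift_adLin_nsBr (i j : NSI) (f : NSI → ℂ) (p : NSI) :
    lift adLin (nsBr i j) f p =
      adf i (adf j f) p - sg (nsPar i) (nsPar j) * adf j (adf i f) p := by
  rcases i with n | n | ⟨_ | _, n⟩ <;> rcases j with m | m | ⟨_ | _, m⟩ <;>
    rcases p with a | a | ⟨_ | _, a⟩ <;>
    simp [nsBr, adLin, adf, nsPar, eps, sg_zero_left, sg_zero_right, sg_one_one] <;>
    ring_nf

lemma isLieBasis : NSd.IsLieBasis where
  homog i j p hp := by
    revert hp
    contrapose
    intro hp
    rw [Finsupp.mem_support_iff, not_not]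
    change nsBr i j p = 0
    change nsPar p ≠ nsPar i + nsPar j at hp
    rcases i with n | n | ⟨_ | _, n⟩ <;> rcases j with m | m | ⟨_ | _, m⟩ <;>
      rcases p with a | a | ⟨_ | _, a⟩ <;> simp [nsBr, nsPar] at hp ⊢ <;> exact absurd rfl hp
  skew i j := by
    change nsBr i j = -sg (nsPar i) (nsPar j) • nsBr j i
    rcases i with n | n | ⟨_ | _, n⟩ <;> rcases j with m | m | ⟨_ | _, m⟩ <;>
      simp [nsBr, nsPar, sg_zero_left, sg_zero_right, sg_one_one, add_comm m n]
  jacobi i j k := isCoordAd.jacobi (fun i j f => funext fun p => lift_adLin_nsBr i j f p) i j k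

/-- The index of a basis element. -/
def idx : NSI → ℤ
  | .L m => m
  | .I m => m
  | .G _ k => k

/-- The `U(1)`-charge of a basis element. -/
def charge : NSI → ℤ
  | .G true _ => 1
  | .G false _ => -1
  | _ => 0

lemma exists_idx_bound {α : Type*} (v : α →₀ ℂ) (g : α → ℤ) :
    ∃ K, ∀ a, v a ≠ 0 → |g a| ≤ K := by
  obtain ⟨K, hK⟩ := (v.support.image fun a => |g a|).bddAbove
  exact ⟨K, fun a ha => hK (by
    simpa using ⟨a, ha, rfl⟩)⟩

/-- A finitely supported function that keeps being nonzero along a line vanishes on it. -/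
lemma eq_zero_of_shift {α : Type*} (v : α →₀ ℂ) (φ : ℤ → α) (hφ : Function.Injective φ)
    (h : ∀ k, v (φ (k + 1)) = 0 → v (φ k) = 0) (k : ℤ) : v (φ k) = 0 := by
  by_contra hk
  have key (n : ℕ) : v (φ (k + n)) ≠ 0 := by
    induction n with
    | zero => simpa using hk
    | succ n ih => exact fun h0 => ih (h _ (by rw [← h0]; push_cast; ring_nf))
  have hinj : Function.Injective fun n : ℕ => φ (k + n) := fun m n hmn => by
    have := hφ hmn; simpa using this
  exact Set.infinite_of_injective_forall_mem hinj
    (s := (v.support : Set α)) (fun n => by simpa using key n) v.support.finite_toSet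

lemma eq_zero_of_adf (f : NSI → ℂ) (K : ℤ) (h : ∀ x i, K < idx i → adf x f i = 0) (i : NSI) :
    f i = 0 := by
  have hL (m : ℤ) : f (.L m) = 0 := by
    have := h (.L (|K| + 2 * |m| + 1)) (.L (m + (|K| + 2 * |m| + 1)))
      (by simp only [idx]; have := neg_abs_le m; have := le_abs_self K; have := abs_nonneg m; omega)
    simp only [adf, add_sub_cancel_right, mul_eq_zero] at this
    refine this.resolve_left ?_
    have : |K| + 2 * |m| + 1 - m ≠ 0 := by
      have := le_abs_self m; have := abs_nonneg K; have := abs_nonneg m; omega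
    rw [← Int.cast_ne_zero (α := ℂ)] at this
    contrapose! this
    rw [← this]; push_cast; ring
  rcases i with m | m | ⟨s, k⟩
  · exact hL m
  · by_cases hm : m = 0
    · subst hm
      have := h (.G true (|K| + 1)) (.G true (|K| + 1))
        (by simp only [idx]; have := le_abs_self K; omega)
      simpa [adf, hL, eps] using this
    · have := h (.L (|K| + 2 * |m| + 1)) (.I (m + (|K| + 2 * |m| + 1)))
        (by simp only [idx]; have := neg_abs_le m; have := le_abs_self K; have := abs_nonneg m; omega)
      simp only [adf, add_sub_cancel_right, mul_eq_zero] at this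
      refine this.resolve_left ?_
      push_cast
      simpa using hm
  · have := h (.L (|K| + 2 * |k| + 2)) (.G s (k + (|K| + 2 * |k| + 2)))
      (by simp only [idx]; have := neg_abs_le k; have := le_abs_self K; have := abs_nonneg k; omega)
    simp only [adf, add_sub_cancel_right, mul_eq_zero] at this
    refine this.resolve_left ?_
    have : |K| + 2 * |k| + 1 - 2 * k ≠ 0 := by
      have := le_abs_self k; have := abs_nonneg K; omega
    rw [← Int.cast_ne_zero (α := ℂ)] at this
    contrapose! this
    rw [← mul_eq_zero_of_left this 2]; push_cast; ring

/-- The adjoint action of a basis element on the tensor square. -/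
def act (x : NSI) : (NSI × NSI →₀ ℂ) →ₗ[ℂ] (NSI × NSI →₀ ℂ) := NSd.star2 (NSd.e x)

lemma act_apply (x : NSI) (v : NSI × NSI →₀ ℂ) (i j : NSI) :
    act x v (i, j) = adf x (fun k => v (k, j)) i +
      sg (nsPar x) (nsPar i) * adf x (fun k => v (i, k)) j :=
  isCoordAd.star2_apply x v i j

lemma eq_zero_of_act (v : NSI × NSI →₀ ℂ) (h : ∀ x, act x v = 0) : v = 0 := by
  obtain ⟨K, hK⟩ := exists_idx_bound v fun p => idx p.1
  ext ⟨i, j⟩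
  refine eq_zero_of_adf (fun i => v (i, j)) K (fun x i hi => ?_) i
  have h0 (k) : v (i, k) = 0 := by
    by_contra hne
    have := (le_abs_self _).trans (hK (i, k) hne)
    simp only at this; omega
  simpa [h, h0] using (act_apply x v i j).symm

/-- The adjoint action of a basis element on the tensor cube. -/
def act3 (x : NSI) : (NSI × NSI × NSI →₀ ℂ) →ₗ[ℂ] (NSI × NSI × NSI →₀ ℂ) := NSd.star3 (NSd.e x)

lemma act3_apply (x : NSI) (v : NSI × NSI × NSI →₀ ℂ) (i j k : NSI) :
    act3 x v (i, j, k) = adf x (fun l => v (l, j, k)) i +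
      sg (nsPar x) (nsPar i) * adf x (fun l => v (i, l, k)) j +
      sg (nsPar x) (nsPar i) * sg (nsPar x) (nsPar j) * adf x (fun l => v (i, j, l)) k :=
  isCoordAd.star3_apply x v i j k

lemma eq_zero_of_act3 (v : NSI × NSI × NSI →₀ ℂ) (h : ∀ x, act3 x v = 0) : v = 0 := by
  obtain ⟨K, hK⟩ := exists_idx_bound v fun p => idx p.1
  ext ⟨i, j, k⟩
  refine eq_zero_of_adf (fun i => v (i, j, k)) K (fun x i hi => ?_) i
  have h0 (l m) : v (i, l, m) = 0 := by
    by_contra hne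
    have := (le_abs_self _).trans (hK (i, l, m) hne)
    simp only at this; omega
  simpa [h, h0] using (act3_apply x v i j k).symm

lemma adf_graded {x : NSI} {f : NSI → ℂ} {i : NSI} (h : adf x f i ≠ 0) :
    ∃ k, f k ≠ 0 ∧ deg2 k + deg2 x = deg2 i ∧ charge k + charge x = charge i := by
  rcases x with n | n | ⟨_ | _, n⟩ <;> rcases i with a | a | ⟨_ | _, a⟩ <;>
    simp only [adf, ne_eq, not_true_eq_false, reduceIte, reduceCtorEq] at h
  all_goals first
    | exact ⟨_, right_ne_zero_of_mul h, by simp only [deg2]; ring, by simp [charge]⟩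
    | skip
  all_goals
    by_cases h1 : f (.L (a - n)) = 0
    · exact ⟨.I (a - n), fun h2 => h (by simp [h1, h2]), by simp only [deg2]; ring,
        by simp [charge]⟩
    · exact ⟨.L (a - n), h1, by simp only [deg2]; ring, by simp [charge]⟩

lemma act_graded {x : NSI} {v : NSI × NSI →₀ ℂ} {p : NSI × NSI} (h : act x v p ≠ 0) :
    ∃ q, v q ≠ 0 ∧ deg2 q.1 + deg2 q.2 + deg2 x = deg2 p.1 + deg2 p.2 ∧
      charge q.1 + charge q.2 + charge x = charge p.1 + charge p.2 := by
  obtain ⟨i, j⟩ := p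
  rw [act_apply] at h
  by_cases h1 : adf x (fun k => v (k, j)) i = 0
  · rw [h1, zero_add] at h
    obtain ⟨k, hk, hd, hc⟩ := adf_graded (right_ne_zero_of_mul h)
    exact ⟨(i, k), hk, by simp only; omega, by simp only; omega⟩
  · obtain ⟨k, hk, hd, hc⟩ := adf_graded h1
    exact ⟨(k, j), hk, by simp only; omega, by simp only; omega⟩

/-- An even `1`-cocycle with values in the tensor square, given by its values on the basis. -/
def IsCocycle (v : NSI → NSI × NSI →₀ ℂ) : Prop :=
  ∀ i j, lift v (nsBr i j) = act i (v j) - sg (nsPar i) (nsPar j) • act j (v i)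

lemma IsCocycle.sub {v : NSI → NSI × NSI →₀ ℂ} (hv : IsCocycle v) (w : NSI × NSI →₀ ℂ) :
    IsCocycle fun i => v i - act i w := by
  intro i j
  obtain ⟨f, hf⟩ : ∃ f : (NSI →₀ ℂ) →ₗ[ℂ] (NSI × NSI →₀ ℂ), f = NSd.star2.flip w := ⟨_, rfl⟩
  have h1 : lift (fun i => v i - act i w) = lift v - f := by
    refine Finsupp.lhom_ext' fun k => LinearMap.ext_ring ?_
    have : f (Finsupp.single k 1) = act k w := by rw [hf]; rfl
    simp [this]
  have h2 : f (nsBr i j) = act i (act j w) - sg (nsPar i) (nsPar j) • act j (act i w) := by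
    rw [hf]; exact isLieBasis.star2_br i j w
  rw [h1, LinearMap.sub_apply, h2, hv, map_sub, map_sub, smul_sub]
  abel

lemma IsCocycle.coeff {v : NSI → NSI × NSI →₀ ℂ} (hv : IsCocycle v) (i j p q : NSI) :
    lift (fun x => v x (p, q)) (nsBr i j) =
      adf i (fun k => v j (k, q)) p + sg (nsPar i) (nsPar p) * adf i (fun k => v j (p, k)) q -
      sg (nsPar i) (nsPar j) * (adf j (fun k => v i (k, q)) p +
        sg (nsPar j) (nsPar p) * adf j (fun k => v i (p, k)) q) := by
  have h1 : lift (fun x => v x (p, q)) = Finsupp.lapply (p, q) ∘ₗ lift v := by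
    refine Finsupp.lhom_ext' fun k => LinearMap.ext_ring ?_
    simp
  rw [h1, LinearMap.comp_apply, hv i j, ← act_apply, ← act_apply]
  rfl

/-- The cocycle `v` is the coboundary of an element of the tensor square. -/
def IsCoboundary (v : NSI → NSI × NSI →₀ ℂ) : Prop := ∃ w, ∀ i, v i = act i w

lemma IsCoboundary.of_sub {v : NSI → NSI × NSI →₀ ℂ} (w : NSI × NSI →₀ ℂ)
    (h : IsCoboundary fun i => v i - act i w) : IsCoboundary v := by
  obtain ⟨u, hu⟩ := h
  exact ⟨u + w, fun i => by rw [map_add, ← hu, sub_add_cancel]⟩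

/-- The cochain `v` preserves the degree and the charge. -/
def Graded (v : NSI → NSI × NSI →₀ ℂ) : Prop := ∀ i p, v i p ≠ 0 →
  deg2 p.1 + deg2 p.2 = deg2 i ∧ charge p.1 + charge p.2 = charge i

/-- The cochain `v` preserves the charge. -/
def Neutral (v : NSI → NSI × NSI →₀ ℂ) : Prop := ∀ i p, v i p ≠ 0 →
  charge p.1 + charge p.2 = charge i

lemma Neutral.sub {v : NSI → NSI × NSI →₀ ℂ} (hv : Neutral v) {w : NSI × NSI →₀ ℂ}
    (hw : ∀ p, w p ≠ 0 → charge p.1 + charge p.2 = 0) : Neutral fun i => v i - act i w := by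
  intro i p hp
  by_cases h : v i p = 0
  · obtain ⟨q, hq, -, hc⟩ := act_graded (x := i) (v := w) (p := p) fun h0 => hp (by simp [h, h0])
    have := hw q hq
    omega
  · exact hv i p h

/-- The eigenvalue of the adjoint action of `L_0 + √-1 I_0`. -/
def weight (i : NSI) : ℂ := deg2 i / 2 + charge i * Complex.I

lemma weight_add_eq_iff {i j k : NSI} : weight i + weight j = weight k ↔
    deg2 i + deg2 j = deg2 k ∧ charge i + charge j = charge k := by
  constructor
  · intro h
    have h1 := congrArg Complex.re h
    have h2 := congrArg Complex.im h
    simp [weight] at h1 h2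
    norm_cast at h2
    refine ⟨?_, h2⟩
    have : (deg2 i : ℝ) + deg2 j = deg2 k := by linarith
    exact_mod_cast this
  · rintro ⟨h1, h2⟩
    rw [weight, weight, weight, ← h1, ← h2]
    push_cast; ring

lemma adf_weight (f : NSI → ℂ) (i : NSI) :
    adf (.L 0) f i + Complex.I * adf (.I 0) f i = weight i * f i := by
  rcases i with a | a | ⟨_ | _, a⟩ <;> simp [adf, weight, deg2, charge, eps] <;> ring

lemma act_weight (v : NSI × NSI →₀ ℂ) (p : NSI × NSI) :
    act (.L 0) v p + Complex.I * act (.I 0) v p = (weight p.1 + weight p.2) * v p := by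
  obtain ⟨i, j⟩ := p
  have h1 := adf_weight (fun k => v (k, j)) i
  have h2 := adf_weight (fun k => v (i, k)) j
  simp only [act_apply, nsPar, sg_zero_left]
  linear_combination h1 + h2

lemma lift_weight {M : Type*} [AddCommGroup M] [Module ℂ M] (v : NSI → M) (i : NSI) :
    lift v (nsBr (.L 0) i) + Complex.I • lift v (nsBr (.I 0) i) = weight i • v i := by
  rcases i with a | a | ⟨_ | _, a⟩ <;> simp [nsBr, weight, deg2, charge] <;> module

lemma IsCocycle.exists_graded {v : NSI → NSI × NSI →₀ ℂ} (hv : IsCocycle v) :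
    ∃ w, Graded fun i => v i - act i w := by
  obtain ⟨u, hu⟩ : ∃ u, u = v (.L 0) + Complex.I • v (.I 0) := ⟨_, rfl⟩
  obtain ⟨w, hw⟩ : ∃ w : NSI × NSI →₀ ℂ, ∀ p, w p = u p / (weight p.1 + weight p.2) :=
    ⟨Finsupp.onFinset u.support (fun p => u p / (weight p.1 + weight p.2))
      fun p hp => by simpa using (div_ne_zero_iff.1 hp).1, fun p => rfl⟩
  refine ⟨w, ?_⟩
  have hv' := hv.sub w
  obtain ⟨v', hv'_eq⟩ : ∃ v' : NSI → NSI × NSI →₀ ℂ, v' = fun i => v i - act i w := ⟨_, rfl⟩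
  rw [← hv'_eq] at hv' ⊢
  obtain ⟨u', hu'⟩ : ∃ u', u' = v' (.L 0) + Complex.I • v' (.I 0) := ⟨_, rfl⟩
  have hu'0 (p) (hp : weight p.1 + weight p.2 ≠ 0) : u' p = 0 := by
    have h1 := act_weight w p
    have h2 : u' p = u p - (act (.L 0) w p + Complex.I * act (.I 0) w p) := by
      simp only [hu', hu, hv'_eq, Finsupp.add_apply, Finsupp.sub_apply, Finsupp.smul_apply,
        smul_eq_mul]
      ring
    rw [h2, h1, hw, mul_div_cancel₀ _ hp, sub_self]
  have key (i p) : act i u' p = (weight p.1 + weight p.2 - weight i) * v' i p := by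
    have h1 := lift_weight v' i
    rw [hv', hv'] at h1
    have h2 := congrArg (fun f => f p) h1
    have h3 := act_weight (v' i) p
    have h4 : act i u' p = act i (v' (.L 0)) p + Complex.I * act i (v' (.I 0)) p := by
      simp [hu']
    simp only [nsPar, sg_zero_left, Finsupp.add_apply, Finsupp.sub_apply, Finsupp.smul_apply,
      smul_eq_mul, one_mul] at h2
    linear_combination h4 + h3 - h2
  have hact : u' = 0 := by
    refine eq_zero_of_act _ fun i => ?_
    ext p
    by_contra hne
    obtain ⟨q, hq, hd, hc⟩ := act_graded hne
    rw [key] at hne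
    apply left_ne_zero_of_mul hne
    by_cases hq0 : weight q.1 + weight q.2 = 0
    · have h0 := (weight_add_eq_iff (k := .L 0)).1 (hq0.trans (by simp [weight, deg2, charge]))
      have hd0 : deg2 (.L 0) = 0 := rfl
      have hc0 : charge (.L 0) = 0 := rfl
      rw [sub_eq_zero]
      exact weight_add_eq_iff.2 ⟨by omega, by omega⟩
    · exact absurd (hu'0 q hq0) hq
  intro i p hp
  have := key i p
  rw [hact] at this
  simp only [map_zero, Finsupp.zero_apply, zero_eq_mul, hp, or_false] at this
  exact weight_add_eq_iff.1 (sub_eq_zero.1 this)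

@[simp] lemma charge_L (a : ℤ) : charge (.L a) = 0 := rfl

@[simp] lemma charge_I (a : ℤ) : charge (.I a) = 0 := rfl

@[simp] lemma charge_G (s : Bool) (a : ℤ) : charge (.G s a) = if s then 1 else -1 := by
  cases s <;> rfl

attribute [local simp] nsBr adf nsPar sg_zero_left sg_zero_right sg_one_one

lemma exists_finsupp (F : NSI → NSI → ℂ) (K : ℤ)
    (h : ∀ i j, F i j ≠ 0 → |idx i| ≤ K ∧ |idx j| ≤ K) :
    ∃ w : NSI × NSI →₀ ℂ, ∀ i j, w (i, j) = F i j := by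
  have hfin : {i : NSI | |idx i| ≤ K}.Finite := by
    refine ((((Set.finite_Icc (-K) K).image NSI.L).union ((Set.finite_Icc (-K) K).image NSI.I)).union
      (((Set.finite_Icc (-K) K).image (NSI.G true)).union
        ((Set.finite_Icc (-K) K).image (NSI.G false)))).subset ?_
    rintro (a | a | ⟨_ | _, a⟩) ha <;> simpa [idx, abs_le] using ha
  refine ⟨Finsupp.ofSupportFinite (fun p => F p.1 p.2)
    ((hfin.prod hfin).subset fun p hp => h p.1 p.2 hp), fun i j => rfl⟩

lemma exists_bound (v : NSI × NSI →₀ ℂ) :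
    ∃ K, ∀ K', K ≤ K' → ∀ i j, v (i, j) ≠ 0 → |idx i| ≤ K' ∧ |idx j| ≤ K' := by
  obtain ⟨K₁, h₁⟩ := exists_idx_bound v fun p => idx p.1
  obtain ⟨K₂, h₂⟩ := exists_idx_bound v fun p => idx p.2
  refine ⟨max K₁ K₂, fun K' hK i j hv => ?_⟩
  have := h₁ _ hv
  have := h₂ _ hv
  simp only [max_le_iff] at *
  omega

lemma eps_mul_self (s : Bool) : eps s * eps s = 1 := by cases s <;> simp [eps]

lemma eps_not (s : Bool) : eps (!s) = -eps s := by cases s <;> simp [eps]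

lemma IsCocycle.I_GG {v : NSI → NSI × NSI →₀ ℂ} (hv : IsCocycle v) (hn : Neutral v)
    (h : ∀ s k t l, v (.I 1) (.G s k, .G t l) = 0) (n : ℤ) (s k t l) :
    v (.I n) (.G s k, .G t l) = 0 := by
  by_cases hst : t = !s
  · subst hst
    have := eq_zero_of_shift (v (.I n)) (fun j => (.G s (k + j), .G (!s) (l - j)))
      (fun i j hij => by simpa using hij) (fun j hj => ?_) 0
    · simpa using this
    have := hv.coeff (.I 1) (.I n) (.G s (k + j + 1)) (.G (!s) (l - j))
    cases s <;> simp [h, eps, ← add_assoc, ← sub_sub] at this hj <;> simpa [hj, eq_comm] using this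
  · by_contra h0
    have := hn _ _ h0
    cases s <;> cases t <;> simp at this hst

lemma IsCocycle.exists_I_GG {v : NSI → NSI × NSI →₀ ℂ} (hv : IsCocycle v) (hg : Graded v) :
    ∃ w : NSI × NSI →₀ ℂ, (∀ p, w p ≠ 0 → charge p.1 + charge p.2 = 0) ∧
      ∀ s k t l, (v (.I 1) - act (.I 1) w) (.G s k, .G t l) = 0 := by
  have hn : Neutral v := fun i p h => (hg i p h).2
  have h0 (s k l) : v (.I 0) (.G s k, .G (!s) l) = 0 := by
    have := eq_zero_of_shift (v (.I 0)) (fun j => (.G s (k + j), .G (!s) (l - j)))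
      (fun i j hij => by simpa using hij) (fun j hj => ?_) 0
    · simpa using this
    have := hv.coeff (.I 1) (.I 0) (.G s (k + j + 1)) (.G (!s) (l - j))
    cases s <;> simp [eps, ← add_assoc, ← sub_sub] at this hj <;> simpa [hj, eq_comm] using this
  obtain ⟨K₁, hK₁⟩ := exists_bound (v (.I 1))
  obtain ⟨K₂, hK₂⟩ := exists_bound (v (.L (-1)))
  obtain ⟨w, hw⟩ := exists_finsupp (fun i j => match i, j with
    | .G s k, .G t l => (eps s * (k + 2) * v (.I 1) (.G s (k + 1), .G t l) -
        v (.L (-1)) (.G s k, .G t (l - 1))) / 2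
    | _, _ => 0) (max K₁ K₂ + 1) (by
      rintro (k | k | ⟨s, k⟩) (l | l | ⟨t, l⟩) h <;> try simp at h
      by_cases h1 : v (.I 1) (.G s (k + 1), .G t l) = 0
      · have := hK₂ _ (le_max_right K₁ K₂) _ _ (fun h2 => h (by rw [h1, h2]; simp))
        simp only [idx, abs_le] at *
        omega
      · have := hK₁ _ (le_max_left K₁ K₂) _ _ h1
        simp only [idx, abs_le] at *
        omega)
  refine ⟨w, ?_, fun s k t l => ?_⟩
  · rintro ⟨k | k | ⟨s, k⟩, l | l | ⟨t, l⟩⟩ h <;> rw [hw] at h <;> try simp at h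
    by_cases h1 : v (.I 1) (.G s (k + 1), .G t l) = 0
    · have := hn _ _ (fun h2 => h (by rw [h1, h2]; simp))
      cases s <;> cases t <;> simp at this ⊢
    · have := hn _ _ h1
      cases s <;> cases t <;> simp at this ⊢
  by_cases hst : t = !s
  swap
  · have hz (i k l) (hi : charge i = 0) : v i (.G s k, .G t l) = 0 := by
      by_contra h0
      have := hn _ _ h0
      cases s <;> cases t <;> simp [hi] at this hst
    have hI (n k l) := hz (.I n) k l rfl
    have hL (n k l) := hz (.L n) k l rfl
    simp [act_apply, hw, hI, hL]
  subst hst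
  have key := hv.coeff (.L (-1)) (.I 1) (.G s k) (.G (!s) (l - 1))
  simp [h0, eps_not] at key
  have hkl : (k + l) * v (.I 1) (.G s k, .G (!s) l) = 0 := by
    by_cases h : v (.I 1) (.G s k, .G (!s) l) = 0
    · simp [h]
    · have := (hg _ _ h).1
      simp only [deg2] at this
      rw [mul_eq_zero]
      left
      norm_cast
      omega
  simp [act_apply, hw, eps_not]
  ring_nf at key hkl ⊢
  have := eps_mul_self s
  linear_combination (-1 / 2) * hkl + 1 / 2 * key +
    (-1 / 2 * (k + 1) * v (.I 1) (.G s k, .G (!s) l) +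
      1 / 2 * (k + 2) * v (.I 1) (.G s (1 + k), .G (!s) (-1 + l))) * this

lemma Neutral.eq_zero {v : NSI → NSI × NSI →₀ ℂ} (hn : Neutral v) {i p q : NSI}
    (h : charge p + charge q ≠ charge i) : v i (p, q) = 0 := by
  by_contra h0
  exact h (hn _ _ h0)

lemma eq_int_mul (f : ℤ → ℂ) (h : ∀ m n, f (m + n) = f m + f n) (n : ℤ) : f n = n * f 1 := by
  have := map_zsmul (AddMonoidHom.mk' f h) n 1
  simpa using this

lemma IsCocycle.I_LL {v : NSI → NSI × NSI →₀ ℂ} (hv : IsCocycle v) (n a b : ℤ) :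
    v (.I n) (.L a, .L b) = 0 := by
  rcases eq_or_ne n 0 with rfl | hn
  · simpa [eq_comm] using hv.coeff (.I 1) (.I 0) (.L a) (.I (b + 1))
  have hc : (n : ℂ) ≠ 0 := by exact_mod_cast hn
  have := eq_zero_of_shift (v (.I n)) (fun k => (.L (a - n * k), .L (n * k + b)))
    (fun i j hij => by simpa [hn] using hij) (fun j hj => ?_) 0
  · simpa using this
  have h1 := hv.coeff (.I (2 * n)) (.I n) (.L (a - n * j)) (.I (b + n * j + 2 * n))
  have h2 := hv.coeff (.I (2 * n)) (.I n) (.I (a - n * j + n)) (.L (b + n * (j + 1)))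
  simp at h1 h2
  ring_nf at h1 h2 hj ⊢
  have : 2 * (n : ℂ) * v (.I n) (.L (a - n * j), .L (n * j + b)) = 0 := by
    linear_combination -h1 + h2 + 2 * n * hj
  simpa [hc] using this

/-- The values of `v` on all `I n` lie in the span of the `I a ⊗ I b`. -/
structure ValuesII (v : NSI → NSI × NSI →₀ ℂ) : Prop where
  LL : ∀ n a b, v (.I n) (.L a, .L b) = 0
  LI : ∀ n a b, v (.I n) (.L a, .I b) = 0
  IL : ∀ n a b, v (.I n) (.I a, .L b) = 0
  GG : ∀ n s a t b, v (.I n) (.G s a, .G t b) = 0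

lemma IsCocycle.I_IL {v : NSI → NSI × NSI →₀ ℂ} (hv : IsCocycle v)
    (hGG : ∀ n s a t b, v (.I n) (.G s a, .G t b) = 0)
    (hLI : ∀ n a b, v (.I n) (.L a, .I b) = 0) (n a b : ℤ) : v (.I n) (.I a, .L b) = 0 := by
  have hadd (a b m n : ℤ) : v (.I (m + n)) (.I (a + (m + n)), .L b) =
      v (.I m) (.I (a + m), .L b) + v (.I n) (.I (a + n), .L b) := by
    have h1 := hv.coeff (.I (m + n)) (.G true 0) (.G true (a + (m + n))) (.L b)
    have h2 := hv.coeff (.I m) (.G true 0) (.G true (a + m)) (.L b)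
    have h3 := hv.coeff (.I n) (.G true m) (.G true (a + m + n)) (.L b)
    simp [hv.I_LL, hGG, eps] at h1 h2 h3
    ring_nf at h1 h2 h3 ⊢
    linear_combination -h1 + h2 + h3
  have hmul (n a b : ℤ) : v (.I n) (.I (a + n), .L b) = n * v (.I 1) (.I (a + 1), .L b) :=
    eq_int_mul (fun n => v (.I n) (.I (a + n), .L b)) (hadd a b) n
  have h0 (a b : ℤ) : v (.I 1) (.I a, .L b) = 0 := by
    have := eq_zero_of_shift (v (.I 1)) (fun k => (.I (a - k), .L (b + k)))
      (fun i j hij => by simpa using hij) (fun j hj => ?_) 0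
    · simpa using this
    have h1 := hv.coeff (.I 2) (.I 1) (.I (a - j)) (.I (b + j + 2))
    have h2 := hmul 2 (a - j - 2) (b + j + 1)
    simp [hLI] at h1
    ring_nf at h1 h2 hj ⊢
    linear_combination (-1 / 2) * h1 + 1 / 2 * h2 + hj
  have := hmul n (a - n) b
  rw [h0] at this
  simpa using this

lemma IsCocycle.exists_valuesII {v : NSI → NSI × NSI →₀ ℂ} (hv : IsCocycle v)
    (hGG : ∀ n s a t b, v (.I n) (.G s a, .G t b) = 0) :
    ∃ w : NSI × NSI →₀ ℂ, (∀ p, w p ≠ 0 → charge p.1 + charge p.2 = 0) ∧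
      ValuesII fun i => v i - act i w := by
  have hadd (a b m n : ℤ) : v (.I (m + n)) (.L a, .I (b + (m + n))) =
      v (.I m) (.L a, .I (b + m)) + v (.I n) (.L a, .I (b + n)) := by
    have h1 := hv.coeff (.I (m + n)) (.G true 0) (.L a) (.G true (b + (m + n)))
    have h2 := hv.coeff (.I m) (.G true 0) (.L a) (.G true (b + m))
    have h3 := hv.coeff (.I n) (.G true m) (.L a) (.G true (b + m + n))
    simp [hv.I_LL, hGG, eps] at h1 h2 h3
    ring_nf at h1 h2 h3 ⊢
    linear_combination -h1 + h2 + h3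
  have hmul (n a b : ℤ) : v (.I n) (.L a, .I (b + n)) = n * v (.I 1) (.L a, .I (b + 1)) :=
    eq_int_mul (fun n => v (.I n) (.L a, .I (b + n))) (hadd a b) n
  obtain ⟨K, hK⟩ := exists_bound (v (.I 1))
  obtain ⟨w, hw⟩ := exists_finsupp (fun i j => match i, j with
    | .L a, .L b => v (.I 1) (.L a, .I (b + 1))
    | _, _ => 0) (K + 1) (by
      rintro (a | a | ⟨s, a⟩) (b | b | ⟨t, b⟩) h <;> try simp at h
      have := hK _ le_rfl _ _ h
      simp only [idx, abs_le] at *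
      omega)
  have hwc (p) (h : w p ≠ 0) : charge p.1 + charge p.2 = 0 := by
    obtain ⟨a | a | ⟨s, a⟩, b | b | ⟨t, b⟩⟩ := p <;> rw [hw] at h <;> simp at h ⊢
  have hGG' (n s a t b) : (v (.I n) - act (.I n) w) (.G s a, .G t b) = 0 := by
    simp [act_apply, hw, hGG]
  have hLI' (n a b) : (v (.I n) - act (.I n) w) (.L a, .I b) = 0 := by
    have := hmul n a (b - n)
    simp [act_apply, hw] at this ⊢
    linear_combination this
  exact ⟨w, hwc, (hv.sub w).I_LL, hLI', (hv.sub w).I_IL hGG' hLI', hGG'⟩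

lemma IsCocycle.exists_I_eq_zero {v : NSI → NSI × NSI →₀ ℂ} (hv : IsCocycle v)
    (hn : Neutral v) (hII : ValuesII v) :
    ∃ w : NSI × NSI →₀ ℂ, (∀ p, w p ≠ 0 → charge p.1 + charge p.2 = 0) ∧
      ∀ n, v (.I n) - act (.I n) w = 0 := by
  obtain ⟨hLL, hLI, hIL, hGG⟩ := hII
  have hα (k a b : ℤ) : v (.G true k) (.L a, .G true b) =
      v (.G true 0) (.L a, .G true (b - k)) := by
    have h1 := hv.coeff (.I k) (.G true 0) (.L a) (.G true b)
    simp [hLL, hLI, hGG, eps] at h1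
    exact h1
  have hadd (a b m n : ℤ) :
      v (.I (m + n)) (.I a, .I (b + (m + n))) + (m + n : ℤ) *
        v (.G true 0) (.L (a - (m + n)), .G true (b + (m + n))) =
      (v (.I m) (.I a, .I (b + m)) + m * v (.G true 0) (.L (a - m), .G true (b + m))) +
      (v (.I n) (.I a, .I (b + n)) + n * v (.G true 0) (.L (a - n), .G true (b + n))) := by
    have h1 := hv.coeff (.I (m + n)) (.G true 0) (.I a) (.G true (b + (m + n)))
    have h2 := hv.coeff (.I m) (.G true 0) (.I a) (.G true (b + m))
    have h3 := hv.coeff (.I n) (.G true m) (.I a) (.G true (b + m + n))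
    simp [hIL, hGG, eps, hα m] at h1 h2 h3
    push_cast
    ring_nf at h1 h2 h3 ⊢
    linear_combination -h1 + h2 + h3
  have hmul (a b n : ℤ) := eq_int_mul (fun n => v (.I n) (.I a, .I (b + n)) +
    n * v (.G true 0) (.L (a - n), .G true (b + n))) (hadd a b) n
  obtain ⟨K₁, hK₁⟩ := exists_bound (v (.I 1))
  obtain ⟨K₂, hK₂⟩ := exists_bound (v (.G true 0))
  obtain ⟨w, hw⟩ := exists_finsupp (fun i j => match i, j with
    | .L a, .I b => -v (.G true 0) (.L a, .G true b)
    | .I a, .L b => v (.I 1) (.I a, .I (b + 1)) + v (.G true 0) (.L (a - 1), .G true (b + 1))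
    | _, _ => 0) (max K₁ K₂ + 1) (by
      rintro (a | a | ⟨s, a⟩) (b | b | ⟨t, b⟩) h <;> try simp at h
      · have := hK₂ _ (le_max_right K₁ K₂) _ _ h
        simp only [idx, abs_le] at *
        omega
      by_cases h1 : v (.I 1) (.I a, .I (b + 1)) = 0
      · have := hK₂ _ (le_max_right K₁ K₂) _ _ (fun h2 => h (by rw [h1, h2]; simp))
        simp only [idx, abs_le] at *
        omega
      · have := hK₁ _ (le_max_left K₁ K₂) _ _ h1
        simp only [idx, abs_le] at *
        omega)
  have hwc (p) (h : w p ≠ 0) : charge p.1 + charge p.2 = 0 := by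
    obtain ⟨a | a | ⟨s, a⟩, b | b | ⟨t, b⟩⟩ := p <;> rw [hw] at h <;> simp at h ⊢
  refine ⟨w, hwc, fun n => ?_⟩
  have hn' := hn.sub hwc
  ext ⟨i, j⟩
  rcases i with a | a | ⟨s, a⟩ <;> rcases j with b | b | ⟨t, b⟩
  case I.I =>
    have := hmul a (b - n) n
    simp [act_apply, hw] at this ⊢
    linear_combination this
  all_goals first
    | (simp [act_apply, hw, hLL, hLI, hIL, hGG]; done)
    | exact hn'.eq_zero (by cases s <;> simp)
    | exact hn'.eq_zero (by cases t <;> simp)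

/-- If `v` kills all `I n`, then its value on each `L n` lies in the span of the `I a ⊗ I b`. -/
lemma IsCocycle.L_eq_zero {v : NSI → NSI × NSI →₀ ℂ} (hv : IsCocycle v) (hn : Neutral v)
    (hI : ∀ n, v (.I n) = 0) (n : ℤ) (p : NSI × NSI) (hp : ∀ a b, p ≠ (.I a, .I b)) :
    v (.L n) p = 0 := by
  have hIL (a b) : v (.L n) (.I a, .L b) = 0 := by
    have := eq_zero_of_shift (v (.L n)) (fun k => (.I (a + k), .L (b - k)))
      (fun i j hij => by simpa using hij) (fun j hj => ?_) 0
    · simpa using this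
    have h1 := hv.coeff (.I 1) (.L n) (.I (a + j)) (.I (b - j + 1))
    have h2 := hv.coeff (.I 2) (.L n) (.I (a + j + 1)) (.I (b - j + 1))
    simp [hI] at h1 h2
    ring_nf at h1 h2 hj ⊢
    linear_combination -h1 + h2 / 2 + hj
  obtain ⟨a | a | ⟨s, a⟩, b | b | ⟨t, b⟩⟩ := p
  case I.I => exact absurd rfl (hp a b)
  case I.L => exact hIL a b
  case L.L => simpa [hI, eq_comm] using hv.coeff (.I 1) (.L n) (.L a) (.I (b + 1))
  case L.I => simpa [hI, hIL, eq_comm] using hv.coeff (.I 1) (.L n) (.I (a + 1)) (.I b)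
  case G.G =>
    by_cases hst : t = !s
    · subst hst
      have := eq_zero_of_shift (v (.L n)) (fun k => (.G s (a + k), .G (!s) (b - k)))
        (fun i j hij => by simpa using hij) (fun j hj => ?_) 0
      · simpa using this
      have := hv.coeff (.I 1) (.L n) (.G s (a + j + 1)) (.G (!s) (b - j))
      cases s <;> simp [hI, eps, ← add_assoc, ← sub_sub] at this hj <;>
        simpa [hj, eq_comm] using this
    · exact hn.eq_zero (by cases s <;> cases t <;> simp at hst ⊢)
  all_goals first
    | exact hn.eq_zero (by cases s <;> simp)
    | exact hn.eq_zero (by cases t <;> simp)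

lemma IsCocycle.G_LG {v : NSI → NSI × NSI →₀ ℂ} (hv : IsCocycle v)
    (hI : ∀ n, v (.I n) = 0) (k a b : ℤ) : v (.G true k) (.L a, .G true b) = 0 := by
  have := eq_zero_of_shift (v (.G true k)) (fun j => (.L (a + j), .G true (b - j)))
    (fun i j hij => by simpa using hij) (fun j hj => ?_) 0
  · simpa using this
  have h1 := hv.coeff (.I 1) (.G true (k + 1)) (.I (a + j + 2)) (.G true (b - j))
  have h2 := hv.coeff (.I 1) (.G true k) (.I (a + j + 2)) (.G true (b - j - 1))
  have h3 := hv.coeff (.I 2) (.G true k) (.I (a + j + 2)) (.G true (b - j))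
  have h4 := hv.coeff (.I 1) (.G true k) (.L (a + j + 1)) (.G true (b - j))
  simp [hI, eps] at h1 h2 h3 h4
  ring_nf at h1 h2 h3 h4 hj ⊢
  linear_combination h1 / 2 + h2 / 2 + h4 / 2 - h3 / 2 + hj

lemma IsCocycle.G_GL {v : NSI → NSI × NSI →₀ ℂ} (hv : IsCocycle v)
    (hI : ∀ n, v (.I n) = 0) (k a b : ℤ) : v (.G true k) (.G true a, .L b) = 0 := by
  have := eq_zero_of_shift (v (.G true k)) (fun j => (.G true (a - j), .L (b + j)))
    (fun i j hij => by simpa using hij) (fun j hj => ?_) 0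
  · simpa using this
  have h1 := hv.coeff (.I 1) (.G true (k + 1)) (.G true (a - j)) (.I (b + j + 2))
  have h2 := hv.coeff (.I 1) (.G true k) (.G true (a - j - 1)) (.I (b + j + 2))
  have h3 := hv.coeff (.I 2) (.G true k) (.G true (a - j)) (.I (b + j + 2))
  have h4 := hv.coeff (.I 1) (.G true k) (.G true (a - j)) (.L (b + j + 1))
  simp [hI, eps] at h1 h2 h3 h4
  ring_nf at h1 h2 h3 h4 hj ⊢
  linear_combination h1 / 2 + h2 / 2 + h4 / 2 - h3 / 2 + hj

lemma IsCocycle.exists_G_IG {v : NSI → NSI × NSI →₀ ℂ} (hv : IsCocycle v)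
    (hI : ∀ n, v (.I n) = 0) :
    ∃ w : NSI × NSI →₀ ℂ, (∀ p, w p ≠ 0 → charge p.1 + charge p.2 = 0) ∧
      (∀ n, v (.I n) - act (.I n) w = 0) ∧
      ∀ k a b, (v (.G true k) - act (.G true k) w) (.I a, .G true b) = 0 := by
  obtain ⟨K, hK⟩ := exists_bound (v (.G true 0))
  obtain ⟨w, hw⟩ := exists_finsupp (fun i j => match i, j with
    | .I a, .I b => -v (.G true 0) (.I a, .G true b)
    | _, _ => 0) K (by
      rintro (a | a | ⟨s, a⟩) (b | b | ⟨t, b⟩) h <;> try simp at h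
      have := hK _ le_rfl _ _ h
      simpa only [idx] using this)
  refine ⟨w, ?_, fun n => ?_, fun k a b => ?_⟩
  · rintro ⟨a | a | ⟨s, a⟩, b | b | ⟨t, b⟩⟩ h <;> rw [hw] at h <;> simp at h ⊢
  · ext ⟨a | a | ⟨s, a⟩, b | b | ⟨t, b⟩⟩ <;> simp [act_apply, hw, hI]
  · have := hv.coeff (.I k) (.G true 0) (.I a) (.G true b)
    simp [hI, eps, hv.G_LG hI] at this
    simp [act_apply, hw, eps, this]

lemma IsCocycle.eq_zero {v : NSI → NSI × NSI →₀ ℂ} (hv : IsCocycle v) (hn : Neutral v)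
    (hI : ∀ n, v (.I n) = 0) (hIG : ∀ k a b, v (.G true k) (.I a, .G true b) = 0) (i : NSI) :
    v i = 0 := by
  have hL (n) : v (.L n) = 0 := by
    ext ⟨p, q⟩
    by_cases hp : ∃ a b, (p, q) = (NSI.I a, NSI.I b)
    · obtain ⟨a, b, hab⟩ := hp
      have h1 (a b) := hv.L_eq_zero hn hI n (.I a, .L b) (by simp)
      have h2 (s a b) := hv.L_eq_zero hn hI n (.G s a, .G true b) (by simp)
      simpa [hab, hIG, h1, h2, eps, eq_comm] using hv.coeff (.L n) (.G true 0) (.I a) (.G true b)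
    · exact hv.L_eq_zero hn hI n _ fun a b h => hp ⟨a, b, h⟩
  have hplus (k) : v (.G true k) = 0 := by
    have hGI (a b) : v (.G true k) (.G true a, .I b) = 0 := by
      have := hv.coeff (.G true k) (.G true k) (.G true a) (.G true (b + k))
      simp [hIG, hv.G_LG hI, hv.G_GL hI, eps] at this
      linear_combination -this / 2
    ext ⟨a | a | ⟨s, a⟩, b | b | ⟨t, b⟩⟩
    case L.G => cases t; exacts [hn.eq_zero (by simp), hv.G_LG hI k a b]
    case I.G => cases t; exacts [hn.eq_zero (by simp), hIG k a b]
    case G.L => cases s; exacts [hn.eq_zero (by simp), hv.G_GL hI k a b]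
    case G.I => cases s; exacts [hn.eq_zero (by simp), hGI a b]
    all_goals exact hn.eq_zero (by first | (simp; done) | (cases s <;> cases t <;> simp))
  have hminus (l) : v (.G false l) = 0 := by
    have hLG (a b) : v (.G false l) (.L a, .G false b) = 0 := by
      have := eq_zero_of_shift (v (.G false l)) (fun j => (.L (a + j), .G false (b - j)))
        (fun i j hij => by simpa using hij) (fun j hj => ?_) 0
      · simpa using this
      have h1 := hv.coeff (.G true 0) (.G false l) (.L (a + j)) (.L (b - j + 1))
      have h2 := hv.coeff (.G true 1) (.G false l) (.L (a + j + 1)) (.L (b - j + 1))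
      simp [hI, hL, hplus] at h1 h2
      ring_nf at h1 h2 hj ⊢
      linear_combination h2 / 2 - h1 / 2 + hj
    have hGL (a b) : v (.G false l) (.G false a, .L b) = 0 := by
      simpa [hI, hL, hplus, hLG] using hv.coeff (.G true 0) (.G false l) (.L (a + 1)) (.L b)
    have hGI (a b) : v (.G false l) (.G false a, .I b) = 0 := by
      simpa [hI, hL, hplus, hLG] using hv.coeff (.G true 0) (.G false l) (.L (a + 1)) (.I b)
    have hIG' (a b) : v (.G false l) (.I a, .G false b) = 0 := by
      simpa [hI, hL, hplus, hGL] using hv.coeff (.G true 0) (.G false l) (.I a) (.L (b + 1))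
    ext ⟨a | a | ⟨s, a⟩, b | b | ⟨t, b⟩⟩
    case L.G => cases t; exacts [hLG a b, hn.eq_zero (by simp)]
    case I.G => cases t; exacts [hIG' a b, hn.eq_zero (by simp)]
    case G.L => cases s; exacts [hGL a b, hn.eq_zero (by simp)]
    case G.I => cases s; exacts [hGI a b, hn.eq_zero (by simp)]
    all_goals exact hn.eq_zero (by first | (simp; done) | (cases s <;> cases t <;> simp))
  rcases i with n | n | ⟨_ | _, n⟩
  exacts [hL n, hI n, hminus n, hplus n]

/-- The first cohomology with coefficients in the tensor square vanishes. -/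
theorem IsCocycle.isCoboundary {v : NSI → NSI × NSI →₀ ℂ} (hv : IsCocycle v) :
    IsCoboundary v := by
  obtain ⟨w₀, hg⟩ := hv.exists_graded
  refine .of_sub w₀ ?_
  have hv₀ := hv.sub w₀
  have hn₀ : Neutral fun i => v i - act i w₀ := fun i p h => (hg i p h).2
  obtain ⟨w₁, hw₁, h₁⟩ := hv₀.exists_I_GG hg
  have hv₁ := hv₀.sub w₁
  have hn₁ := hn₀.sub hw₁
  refine .of_sub w₁ ?_
  obtain ⟨w₂, hw₂, h₂⟩ := hv₁.exists_valuesII (hv₁.I_GG hn₁ h₁)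
  have hv₂ := hv₁.sub w₂
  have hn₂ := hn₁.sub hw₂
  refine .of_sub w₂ ?_
  obtain ⟨w₃, hw₃, h₃⟩ := hv₂.exists_I_eq_zero hn₂ h₂
  have hv₃ := hv₂.sub w₃
  have hn₃ := hn₂.sub hw₃
  refine .of_sub w₃ ?_
  obtain ⟨w₄, hw₄, h₄, h₅⟩ := hv₃.exists_G_IG h₃
  refine .of_sub w₄ ⟨0, fun i => ?_⟩
  rw [map_zero]
  exact (hv₃.sub w₄).eq_zero (hn₃.sub hw₄) h₄ h₅ i

end NSd

namespace NSd

lemma nsPar_eq_charge (i : NSI) : nsPar i = (charge i : ℤ) := by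
  rcases i with a | a | ⟨_ | _, a⟩ <;> simp [nsPar]

lemma act_nsPar {i : NSI} {r : NSI × NSI →₀ ℂ} {p : NSI × NSI} {a : ZMod 2}
    (hr : ∀ q, r q ≠ 0 → nsPar q.1 + nsPar q.2 = a) (hp : act i r p ≠ 0) :
    nsPar p.1 + nsPar p.2 = a + nsPar i := by
  obtain ⟨q, hq, -, hc⟩ := act_graded hp
  have := congrArg (Int.cast (R := ZMod 2)) hc
  push_cast at this
  simp only [← nsPar_eq_charge] at this
  rw [← hr q hq, this]

/-- If `r` induces an even coboundary, then `r` is even. -/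
lemma isEven_of_act {r : NSI × NSI →₀ ℂ}
    (h : ∀ i p, act i r p ≠ 0 → nsPar p.1 + nsPar p.2 = nsPar i) (p : NSI × NSI)
    (hp : r p ≠ 0) : nsPar p.1 + nsPar p.2 = 0 := by
  obtain ⟨r₀, hr₀⟩ : ∃ r₀, r₀ = r.filter fun q => nsPar q.1 + nsPar q.2 = 0 := ⟨_, rfl⟩
  obtain ⟨r₁, hr₁⟩ : ∃ r₁, r₁ = r.filter fun q => ¬nsPar q.1 + nsPar q.2 = 0 := ⟨_, rfl⟩
  have hr : r₀ + r₁ = r := by rw [hr₀, hr₁]; exact r.filter_add_filter_not _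
  have h₀ (q) (hq : r₀ q ≠ 0) : nsPar q.1 + nsPar q.2 = 0 := by
    contrapose hq
    simp [hr₀, hq]
  have h₁ (q) (hq : r₁ q ≠ 0) : nsPar q.1 + nsPar q.2 = 1 := by
    refine (zmod_two_cases _).resolve_left fun h0 => hq ?_
    simp [hr₁, h0]
  have hz : r₁ = 0 := by
    refine eq_zero_of_act _ fun i => ?_
    ext q
    by_contra hq
    have hodd := act_nsPar h₁ hq
    have hne : nsPar q.1 + nsPar q.2 ≠ nsPar i := by simp [hodd]
    have h0 : act i r₀ q = 0 := by
      by_contra h0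
      exact hne (by simpa using act_nsPar h₀ h0)
    refine hne (h i q ?_)
    rw [← hr, map_add, Finsupp.add_apply, h0, zero_add]
    exact hq
  rw [← hr, hz, add_zero] at hp
  exact h₀ p hp

end NSd

/-- every Lie superbialgebra structure on the centerless `N=2`
superconformal Neveu–Schwarz algebra is triangular coboundary. -/
theorem NS_bialgebra_triangular_coboundary (Δf : NSd.V →ₗ[ℂ] NSd.T2)
    (h : NSd.IsSBialg Δf) :
    ∃ r : NSd.T2, NSd.IsEven2 r ∧ r ∈ NSd.ImSkew ∧ NSd.cybe r = 0 ∧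
      ∀ x : NSd.V, Δf x = NSd.star2 x r := by
  obtain ⟨hpar, hskew, hjac, hcoc⟩ := h
  obtain ⟨v, hv⟩ : ∃ v : NSI → NSI × NSI →₀ ℂ, v = fun i => Δf (NSd.e i) := ⟨_, rfl⟩
  have hΔv : Δf = lift v := by
    rw [hv]; exact hom_ext fun i => (lift_e (D := NSd) (fun i => Δf (NSd.e i)) i).symm
  have hc : NSd.IsCocycle v := fun i j => by
    rw [← hΔv, hv]
    exact hcoc i j
  obtain ⟨r, hr⟩ := hc.isCoboundary
  obtain ⟨r, hr⟩ : ∃ r : NSd.T2, ∀ i : NSI, v i = NSd.act i r := ⟨r, hr⟩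
  have hact (i : NSd.ι) : Δf (NSd.e i) = NSd.act i r := (congrFun hv i).symm.trans (hr i)
  have hΔ : Δf = NSd.star2.flip r := hom_ext hact
  have heven : NSd.IsEven2 r := fun p hp =>
    NSd.isEven_of_act (fun i q hq => hpar (nsPar i) (NSd.e i)
      (fun j hj => by rw [Finset.mem_singleton.1 (Finsupp.support_single_subset hj)]; rfl) q
      (Finsupp.mem_support_iff.2 ((congrArg (fun f => f q) (hact i)).trans_ne hq))) p (Finsupp.mem_support_iff.1 hp)
  have htau : NSd.tau r = -r := by
    refine add_eq_zero_iff_eq_neg.1 (NSd.eq_zero_of_act _ fun x => ?_)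
    have h1 := NSd.isLieBasis.tau_star2 x r
    have h2 := tau_of_mem_ImSkew (hskew (NSd.e x))
    have h3 : NSd.tau (NSd.star2 (NSd.e x) r) = -NSd.star2 (NSd.e x) r := by
      rw [hΔ] at h2; exact h2
    exact (map_add (NSd.act x) _ _).trans (add_eq_zero_iff_eq_neg.2 (h1.symm.trans h3))
  refine ⟨r, heven, mem_ImSkew_of_tau htau, NSd.eq_zero_of_act3 _ fun x => ?_,
    fun x => by rw [hΔ]; rfl⟩
  have h1 := hjac (NSd.e x)
  rw [hΔ] at h1
  exact (NSd.isLieBasis.coJacobi_eq_star3_cybe x heven htau).symm.trans h1
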